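/- arXiv:1607.03591 — 7 statements merged into one kernel-verified Lean document; each statement's English description precedes it below -/
import Mathlib

section
/- (Fernique's theorem) Let μ be a Gaussian measure on a separable Banach space W. Then there exist constants ε > 0 and C > 0 such that for all t ≥ 0, μ({x ∈ W : ‖x‖ ≥ t}) ≤ C·e^{-ε t²}. -/
open MeasureTheory ProbabilityTheory
open scoped NNReal ENNReal

/-- A Borel probability measure on a separable Banach space is Gaussian if every
continuous linear functional, viewed as a random variable, has a centered Gaussian
distribution (possibly degenerate, i.e. a Dirac mass at `0`). -/
def IsGaussianMeasure {W : Type*} [NormedAddCommGroup W] [NormedSpace ℝ W]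
    [MeasurableSpace W] (μ : Measure W) : Prop :=
  IsProbabilityMeasure μ ∧ ∀ f : W →L[ℝ] ℝ, ∃ v : ℝ≥0, μ.map f = gaussianReal 0 v

/-- **Fernique's theorem**: a Gaussian measure on a separable Banach space has
Gaussian tails: `μ {‖x‖ ≥ t} ≤ C exp (-ε t²)`. -/
theorem fernique_theorem
    {W : Type*} [NormedAddCommGroup W] [NormedSpace ℝ W] [CompleteSpace W]
    [SecondCountableTopology W] [MeasurableSpace W] [BorelSpace W]
    (μ : Measure W) (hμ : IsGaussianMeasure μ) :
    ∃ ε > (0 : ℝ), ∃ C > (0 : ℝ), ∀ t : ℝ, 0 ≤ t →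
      μ {x : W | t ≤ ‖x‖} ≤ ENNReal.ofReal (C * Real.exp (-ε * t ^ 2)) := by
  obtain ⟨_, hmap⟩ := hμ
  have : IsGaussian μ := isGaussian_of_map_eq_gaussianReal fun L ↦ ⟨0, hmap L⟩
  obtain ⟨ε, hε, hint⟩ := IsGaussian.exists_integrable_exp_sq μ
  refine ⟨ε, hε, ∫ x, Real.exp (ε * ‖x‖ ^ 2) ∂μ, integral_exp_pos hint, fun t ht ↦ ?_⟩
  have markov : Real.exp (ε * t ^ 2) *
      μ.real {x | Real.exp (ε * t ^ 2) ≤ Real.exp (ε * ‖x‖ ^ 2)} ≤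
        ∫ x, Real.exp (ε * ‖x‖ ^ 2) ∂μ :=
    mul_meas_ge_le_integral_of_nonneg (ae_of_all _ fun _ ↦ (Real.exp_pos _).le) hint _
  calc μ {x : W | t ≤ ‖x‖}
  _ ≤ μ {x | Real.exp (ε * t ^ 2) ≤ Real.exp (ε * ‖x‖ ^ 2)} := by
    refine measure_mono fun x (hx : t ≤ ‖x‖) ↦ ?_
    simp only [Set.mem_ofPred_eq]
    gcongr
  _ = ENNReal.ofReal (μ.real {x | Real.exp (ε * t ^ 2) ≤ Real.exp (ε * ‖x‖ ^ 2)}) := by simp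
  _ ≤ ENNReal.ofReal ((∫ x, Real.exp (ε * ‖x‖ ^ 2) ∂μ) * Real.exp (-ε * t ^ 2)) := by
    gcongr
    rw [neg_mul, Real.exp_neg, ← div_eq_mul_inv, le_div_iff₀ (Real.exp_pos _), mul_comm]
    exact markov
end

section
/- Let μ be a Gaussian measure on a separable Banach space W. For θ ∈ ℝ define the rotation R_θ : W × W → W × W by R_θ(x,y) = (x·cos θ − y·sin θ, x·sin θ + y·cos θ). Then the product measure μ × μ is invariant under R_θ, i.e. the pushforward of μ × μ under R_θ equals μ × μ. -/
open MeasureTheory ProbabilityTheory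
open scoped NNReal ENNReal

/-- Rotation invariance of products of Gaussian measures: for a Gaussian measure `μ`
on a separable Banach space `W` and any angle `θ`, the product measure `μ × μ` is
invariant under the rotation
`R_θ (x, y) = (x cos θ − y sin θ, x sin θ + y cos θ)` of `W × W`. -/
theorem prod_gaussian_rotation_invariant
    {W : Type*} [NormedAddCommGroup W] [NormedSpace ℝ W] [CompleteSpace W]
    [SecondCountableTopology W] [MeasurableSpace W] [BorelSpace W]
    (μ : Measure W) (hμ : IsGaussianMeasure μ) (θ : ℝ) :
    (μ.prod μ).map (fun p : W × W =>
        (Real.cos θ • p.1 - Real.sin θ • p.2, Real.sin θ • p.1 + Real.cos θ • p.2))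
      = μ.prod μ := by
  obtain ⟨_, hμ⟩ := hμ
  have hG : IsGaussian μ := isGaussian_of_map_eq_gaussianReal fun L ↦ ⟨0, hμ L⟩
  have hmean (L : StrongDual ℝ W) : μ[L] = 0 := by
    obtain ⟨v, hv⟩ := hμ L
    calc μ[L] = ∫ x, x ∂(μ.map L) := by rw [integral_map (by fun_prop) (by fun_prop)]
      _ = 0 := by rw [hv, integral_id_gaussianReal]
  have hrot : (fun p : W × W =>
      (Real.cos θ • p.1 - Real.sin θ • p.2, Real.sin θ • p.1 + Real.cos θ • p.2))
      = ContinuousLinearMap.rotation (-θ) := by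
    ext p <;> simp [ContinuousLinearMap.rotation_apply, sub_eq_add_neg]
  rw [hrot]
  exact IsGaussian.map_rotation_eq_self_of_forall_strongDual_eq_zero hmean (-θ)
end

section
/- Let μ be a Gaussian measure on a separable Banach space W. Then the inclusion of W* into L²(W, μ) is bounded: there exists a constant C > 0 such that for every f ∈ W*, ∫_W |f(x)|² μ(dx) ≤ C·‖f‖²_{W*}. In fact one may take C = ∫_W ‖x‖²_W μ(dx), which is finite. -/
open MeasureTheory ProbabilityTheory
open scoped NNReal ENNReal

theorem IsGaussianMeasure.isGaussian {W : Type*} [NormedAddCommGroup W] [NormedSpace ℝ W]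
    [MeasurableSpace W] [BorelSpace W] {μ : Measure W} (hμ : IsGaussianMeasure μ) :
    IsGaussian μ :=
  isGaussian_of_map_eq_gaussianReal fun f => ⟨0, hμ.2 f⟩

theorem integral_sq_le_integral_norm_sq_mul {W : Type*} [NormedAddCommGroup W]
    [NormedSpace ℝ W] [MeasurableSpace W] {μ : Measure W}
    (hint : Integrable (fun x => ‖x‖ ^ 2) μ) (f : W →L[ℝ] ℝ) :
    ∫ x, (f x) ^ 2 ∂μ ≤ (∫ x, ‖x‖ ^ 2 ∂μ) * ‖f‖ ^ 2 := by
  rw [← integral_mul_const]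
  refine integral_mono_of_nonneg (.of_forall fun x => sq_nonneg (f x)) (hint.mul_const _)
    (.of_forall fun x => ?_)
  calc (f x) ^ 2 = ‖f x‖ ^ 2 := by simp
    _ ≤ (‖f‖ * ‖x‖) ^ 2 := by gcongr; exact f.le_opNorm x
    _ = ‖x‖ ^ 2 * ‖f‖ ^ 2 := by ring

/-- For a Gaussian measure `μ` on a separable Banach space `W`, the inclusion
`W* ↪ L²(W, μ)` is bounded: `∫ |f x|² dμ ≤ C ‖f‖²_{W*}` for some `C > 0`; in fact
one can take `C = ∫ ‖x‖² dμ(x)`, which is finite. -/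
theorem dual_inclusion_into_L2_bounded
    {W : Type*} [NormedAddCommGroup W] [NormedSpace ℝ W] [CompleteSpace W]
    [SecondCountableTopology W] [MeasurableSpace W] [BorelSpace W]
    (μ : Measure W) (hμ : IsGaussianMeasure μ) :
    Integrable (fun x => ‖x‖ ^ 2) μ ∧
    (∀ f : W →L[ℝ] ℝ, ∫ x, (f x) ^ 2 ∂μ ≤ (∫ x, ‖x‖ ^ 2 ∂μ) * ‖f‖ ^ 2) ∧
    ∃ C > (0 : ℝ), ∀ f : W →L[ℝ] ℝ, ∫ x, (f x) ^ 2 ∂μ ≤ C * ‖f‖ ^ 2 := by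
  have hG := hμ.isGaussian
  have hint : Integrable (fun x => ‖x‖ ^ 2) μ :=
    IsGaussian.memLp_two_id.integrable_norm_pow two_ne_zero
  have hbound := integral_sq_le_integral_norm_sq_mul hint
  refine ⟨hint, hbound, (∫ x, ‖x‖ ^ 2 ∂μ) + 1, by positivity, fun f => ?_⟩
  exact (hbound f).trans (by gcongr; linarith)
end

section
/- (Cameron–Martin theorem for the product Gaussian measure on ℝ^ℕ) Let μ be the countable product of standard Gaussian measures N(0,1) on ℝ^ℕ, a Borel probability measure for the product topology. For y ∈ ℝ^ℕ let μ_y denote the translated measure μ_y(A) = μ(A − y). If h ∈ ℓ² (i.e. ∑_i h(i)² < ∞), then μ_h and μ are mutually absolutely continuous; whereas if y ∈ ℝ^ℕ with ∑_i y(i)² = ∞, then μ_y and μ are mutually singular. -/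
open MeasureTheory ProbabilityTheory
open scoped NNReal ENNReal

/-- Two measures `μ`, `ν` with a bound `ν A ≤ t μ A + K / t` for all `t` and all `A` in a
generating algebra satisfy `ν ≪ μ`. -/
lemma absolutelyContinuous_of_le_mul_add_on_algebra {α : Type*} [mα : MeasurableSpace α]
    {μ ν : Measure α} [IsFiniteMeasure μ] [IsFiniteMeasure ν] {C : Set (Set α)}
    (hC : IsSetAlgebra C) (hgen : mα = MeasurableSpace.generateFrom C) {K : ℝ≥0∞} (hK : K ≠ ∞)
    (hbound : ∀ A ∈ C, ∀ t : ℝ≥0∞, t ≠ 0 → t ≠ ∞ → ν A ≤ t * μ A + t⁻¹ * K) :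
    ν ≪ μ := by
  refine Measure.AbsolutelyContinuous.mk fun s hs hμs ↦ ?_
  have key (n : ℕ) (hn : n ≠ 0) :
      ν s ≤ (n : ℝ≥0∞)⁻¹ + (n : ℝ≥0∞)⁻¹ * K + (n : ℝ≥0∞)⁻¹ * (n : ℝ≥0∞)⁻¹ := by
    have hn0 : (n : ℝ≥0∞) ≠ 0 := by exact_mod_cast hn
    have hnt : (n : ℝ≥0∞) ≠ ∞ := ENNReal.natCast_ne_top n
    have hε : (0 : ℝ≥0∞) < (n : ℝ≥0∞)⁻¹ * (n : ℝ≥0∞)⁻¹ :=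
      ENNReal.mul_pos (ENNReal.inv_ne_zero.2 hnt) (ENNReal.inv_ne_zero.2 hnt)
    obtain ⟨A, hA, hAs⟩ := exists_measure_symmDiff_lt_of_generateFrom_isSetRing (μ := μ + ν)
      hC.isSetRing ⟨{Set.univ}, Set.countable_singleton _, by simpa using hC.univ_mem, by simp⟩
      hgen hs hε
    rw [Measure.add_apply] at hAs
    have hμA : μ A ≤ (n : ℝ≥0∞)⁻¹ * (n : ℝ≥0∞)⁻¹ := by
      calc μ A ≤ μ (symmDiff A s ∪ s) := measure_mono fun x hx ↦ by
            by_cases h : x ∈ s <;> simp [Set.mem_symmDiff, h, hx]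
        _ ≤ μ (symmDiff A s) + μ s := measure_union_le _ _
        _ ≤ _ := by rw [hμs, add_zero]; exact le_self_add.trans hAs.le
    calc ν s ≤ ν (A ∪ symmDiff A s) := measure_mono fun x hx ↦ by
            by_cases h : x ∈ A <;> simp [Set.mem_symmDiff, h, hx]
      _ ≤ ν A + ν (symmDiff A s) := measure_union_le _ _
      _ ≤ (n * μ A + (n : ℝ≥0∞)⁻¹ * K) + (n : ℝ≥0∞)⁻¹ * (n : ℝ≥0∞)⁻¹ :=
          add_le_add (hbound A hA n hn0 hnt) (le_add_self.trans hAs.le)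
      _ ≤ _ := by
          gcongr
          calc (n : ℝ≥0∞) * μ A ≤ n * ((n : ℝ≥0∞)⁻¹ * (n : ℝ≥0∞)⁻¹) := by gcongr
            _ = (n : ℝ≥0∞)⁻¹ := by rw [← mul_assoc, ENNReal.mul_inv_cancel hn0 hnt, one_mul]
  have hinv := ENNReal.tendsto_inv_nat_nhds_zero
  have hlim := (hinv.add (ENNReal.Tendsto.mul_const hinv (Or.inr hK))).add
    (ENNReal.Tendsto.mul hinv (Or.inr ENNReal.zero_ne_top) hinv (Or.inr ENNReal.zero_ne_top))
  simp only [zero_mul, add_zero] at hlim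
  refine le_antisymm (ge_of_tendsto hlim ?_) bot_le
  filter_upwards [Filter.eventually_ne_atTop 0] with n hn using key n hn

/-- Two measures with tests of arbitrarily small total error are mutually singular. -/
lemma mutuallySingular_of_forall_exists_measure_add_compl_le {α : Type*} [MeasurableSpace α]
    {μ ν : Measure α} [SigmaFinite μ] [SigmaFinite ν]
    (h : ∀ ε : ℝ≥0∞, 0 < ε → ∃ A : Set α, μ A + ν Aᶜ ≤ ε) : μ.MutuallySingular ν := by
  refine Measure.mutuallySingular_of_disjoint fun ρ hμ hν ↦ ?_
  have hρ : ρ Set.univ = 0 := by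
    refine le_antisymm (le_of_forall_pos_le_add fun ε hε ↦ ?_) bot_le
    obtain ⟨A, hA⟩ := h ε hε
    calc ρ Set.univ = ρ (A ∪ Aᶜ) := by rw [Set.union_compl_self]
      _ ≤ ρ A + ρ Aᶜ := measure_union_le _ _
      _ ≤ μ A + ν Aᶜ := add_le_add (hμ A) (hν Aᶜ)
      _ ≤ 0 + ε := by rwa [zero_add]
  rw [Measure.measure_univ_eq_zero.1 hρ]
  exact bot_le

lemma lintegral_pi_prod {ι : Type*} [Fintype ι] {X : ι → Type*} [∀ i, MeasurableSpace (X i)]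
    (P : (i : ι) → Measure (X i)) [∀ i, IsProbabilityMeasure (P i)] {f : (i : ι) → X i → ℝ≥0∞}
    (hf : ∀ i, Measurable (f i)) :
    ∫⁻ x, ∏ i, f i (x i) ∂Measure.pi P = ∏ i, ∫⁻ x, f i x ∂P i := by
  refine (lintegral_prod_eq_prod_lintegral_of_indepFun Finset.univ
    (fun i (x : (i : ι) → X i) ↦ f i (x i))
    (iIndepFun_pi fun i ↦ (hf i).aemeasurable)
    fun i ↦ (hf i).comp (measurable_pi_apply i)).trans ?_
  exact Finset.prod_congr rfl fun i _ ↦ (measurePreserving_eval P i).lintegral_comp (hf i)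

lemma pi_withDensity_eq {ι : Type*} [Fintype ι] {X : ι → Type*} [∀ i, MeasurableSpace (X i)]
    (P : (i : ι) → Measure (X i)) [∀ i, IsProbabilityMeasure (P i)] {f : (i : ι) → X i → ℝ≥0∞}
    (hf : ∀ i, Measurable (f i)) [∀ i, SigmaFinite ((P i).withDensity (f i))] :
    Measure.pi (fun i ↦ (P i).withDensity (f i)) =
      (Measure.pi P).withDensity (fun x ↦ ∏ i, f i (x i)) := by
  refine Measure.pi_eq fun s hs ↦ ?_
  rw [withDensity_apply _ (MeasurableSet.univ_pi hs), ← lintegral_indicator (.univ_pi hs)]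
  have (x : (i : ι) → X i) : (Set.univ.pi s).indicator (fun x ↦ ∏ i, f i (x i)) x =
      ∏ i, (s i).indicator (f i) (x i) := by
    by_cases hx : x ∈ Set.univ.pi s
    · rw [Set.indicator_of_mem hx]
      exact Finset.prod_congr rfl fun i _ ↦ (Set.indicator_of_mem (hx i trivial) _).symm
    · rw [Set.indicator_of_notMem hx]
      obtain ⟨i, hi⟩ : ∃ i, x i ∉ s i := by simpa [Set.mem_pi] using hx
      exact (Finset.prod_eq_zero (Finset.mem_univ i) (Set.indicator_of_notMem hi _)).symm
  simp_rw [this]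
  rw [lintegral_pi_prod P fun i ↦ (hf i).indicator (hs i)]
  exact Finset.prod_congr rfl fun i _ ↦ by
    rw [lintegral_indicator (hs i), withDensity_apply _ (hs i)]

/-- The density of `N(m, 1)` with respect to `N(0, 1)`. -/
noncomputable def gaussianShiftDensity (m x : ℝ) : ℝ≥0∞ :=
  ENNReal.ofReal (Real.exp (m * x - m ^ 2 / 2))

lemma measurable_gaussianShiftDensity (m : ℝ) : Measurable (gaussianShiftDensity m) := by
  unfold gaussianShiftDensity
  fun_prop

lemma gaussianReal_withDensity_shiftDensity (m : ℝ) :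
    (gaussianReal 0 1).withDensity (gaussianShiftDensity m) = gaussianReal m 1 := by
  rw [gaussianReal_of_var_ne_zero _ one_ne_zero, gaussianReal_of_var_ne_zero _ one_ne_zero,
    ← withDensity_mul _ (measurable_gaussianPDF 0 1) (measurable_gaussianShiftDensity m)]
  congr 1
  ext x
  rw [Pi.mul_apply, gaussianPDF, gaussianPDF, gaussianShiftDensity,
    ← ENNReal.ofReal_mul (gaussianPDFReal_nonneg _ _ _), gaussianPDFReal, gaussianPDFReal,
    mul_assoc, ← Real.exp_add]
  congr 3
  simp only [NNReal.coe_one]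
  ring

lemma lintegral_gaussianShiftDensity (m : ℝ) :
    ∫⁻ x, gaussianShiftDensity m x ∂gaussianReal 0 1 = 1 := by
  rw [← setLIntegral_univ, ← withDensity_apply _ MeasurableSet.univ,
    gaussianReal_withDensity_shiftDensity, measure_univ]

lemma lintegral_gaussianShiftDensity_sq (m : ℝ) :
    ∫⁻ x, gaussianShiftDensity m x ^ 2 ∂gaussianReal 0 1 = ENNReal.ofReal (Real.exp (m ^ 2)) := by
  have (x : ℝ) : gaussianShiftDensity m x ^ 2 =
      ENNReal.ofReal (Real.exp (m ^ 2)) * gaussianShiftDensity (2 * m) x := by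
    rw [gaussianShiftDensity, gaussianShiftDensity, ← ENNReal.ofReal_mul (Real.exp_nonneg _),
      ← ENNReal.ofReal_pow (Real.exp_nonneg _), ← Real.exp_add, ← Real.exp_nat_mul]
    congr 2
    push_cast
    ring
  simp_rw [this]
  rw [lintegral_const_mul _ (measurable_gaussianShiftDensity _), lintegral_gaussianShiftDensity,
    mul_one]

lemma ENNReal.le_add_inv_mul_sq {t : ℝ≥0∞} (ht0 : t ≠ 0) (ht : t ≠ ∞) (a : ℝ≥0∞) :
    a ≤ t + t⁻¹ * a ^ 2 := by
  rcases le_total a t with h | h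
  · exact h.trans le_self_add
  · calc a = t⁻¹ * (t * a) := by rw [← mul_assoc, ENNReal.inv_mul_cancel ht0 ht, one_mul]
      _ ≤ t⁻¹ * (a * a) := by gcongr
      _ ≤ _ := by rw [sq]; exact le_add_self

lemma pi_gaussianReal_le {ι : Type*} [Fintype ι] (h : ι → ℝ) {S : Set (ι → ℝ)}
    (hS : MeasurableSet S) {t : ℝ≥0∞} (ht0 : t ≠ 0) (ht : t ≠ ∞) :
    Measure.pi (fun i ↦ gaussianReal (h i) 1) S ≤
      t * Measure.pi (fun _ : ι ↦ gaussianReal 0 1) S +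
        t⁻¹ * ENNReal.ofReal (Real.exp (∑ i, h i ^ 2)) := by
  have (i : ι) : SigmaFinite ((gaussianReal 0 1).withDensity (gaussianShiftDensity (h i))) := by
    rw [gaussianReal_withDensity_shiftDensity]; infer_instance
  have hmeas (i : ι) := measurable_gaussianShiftDensity (h i)
  have hF : Measurable fun x : ι → ℝ ↦ (∏ i, gaussianShiftDensity (h i) (x i)) ^ 2 :=
    (Finset.measurable_prod _ fun i _ ↦ (hmeas i).comp (measurable_pi_apply i)).pow_const 2
  simp_rw [← gaussianReal_withDensity_shiftDensity (h _)]
  rw [pi_withDensity_eq _ hmeas, withDensity_apply _ hS]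
  calc ∫⁻ x in S, ∏ i, gaussianShiftDensity (h i) (x i) ∂(Measure.pi fun _ ↦ gaussianReal 0 1)
      ≤ ∫⁻ x in S, (t + t⁻¹ * (∏ i, gaussianShiftDensity (h i) (x i)) ^ 2)
          ∂(Measure.pi fun _ ↦ gaussianReal 0 1) :=
        lintegral_mono fun x ↦ ENNReal.le_add_inv_mul_sq ht0 ht _
    _ = t * Measure.pi (fun _ : ι ↦ gaussianReal 0 1) S +
          t⁻¹ * ∫⁻ x in S, (∏ i, gaussianShiftDensity (h i) (x i)) ^ 2
            ∂(Measure.pi fun _ ↦ gaussianReal 0 1) := by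
        rw [lintegral_add_left measurable_const, setLIntegral_const, lintegral_const_mul _ hF]
    _ ≤ _ := by
        gcongr
        refine (setLIntegral_le_lintegral _ _).trans_eq ?_
        simp_rw [← Finset.prod_pow]
        rw [lintegral_pi_prod _ fun i ↦ (hmeas i).pow_const 2, Real.exp_sum,
          ENNReal.ofReal_prod_of_nonneg fun i _ ↦ Real.exp_nonneg _]
        simp_rw [lintegral_gaussianShiftDensity_sq]

lemma infinitePi_gaussianReal_map_add {ι : Type*} (h : ι → ℝ) :
    (Measure.infinitePi fun _ : ι ↦ gaussianReal 0 1).map (fun x ↦ x + h) =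
      Measure.infinitePi fun i ↦ gaussianReal (h i) 1 := by
  have := Measure.infinitePi_map_pi (fun _ : ι ↦ gaussianReal 0 1)
    (f := fun i x ↦ x + h i) fun i ↦ by fun_prop
  simp only [gaussianReal_map_add_const, zero_add] at this
  exact this

lemma infinitePi_gaussianReal_absolutelyContinuous {ι : Type*} {h : ι → ℝ}
    (hh : Summable fun i ↦ h i ^ 2) :
    (Measure.infinitePi fun i ↦ gaussianReal (h i) 1) ≪
      Measure.infinitePi fun _ : ι ↦ gaussianReal 0 1 := by
  refine absolutelyContinuous_of_le_mul_add_on_algebra isSetAlgebra_measurableCylinders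
    generateFrom_measurableCylinders.symm
    (K := ENNReal.ofReal (Real.exp (∑' i, h i ^ 2))) ENNReal.ofReal_ne_top ?_
  intro A hA t ht0 ht
  obtain ⟨s, S, hS, rfl⟩ := (mem_measurableCylinders A).1 hA
  rw [Measure.infinitePi_cylinder _ hS, Measure.infinitePi_cylinder _ hS]
  refine (pi_gaussianReal_le (fun i : s ↦ h i) hS ht0 ht).trans ?_
  gcongr
  rw [Finset.sum_coe_sort s fun i ↦ h i ^ 2]
  exact hh.sum_le_tsum s fun i _ ↦ sq_nonneg _

lemma variance_sum_mul_infinitePi_gaussianReal {ι : Type*} (y : ι → ℝ) (s : Finset ι) :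
    MemLp (fun x : ι → ℝ ↦ ∑ i ∈ s, y i * x i) 2
        (Measure.infinitePi fun _ : ι ↦ gaussianReal 0 1) ∧
      ∫ x, ∑ i ∈ s, y i * x i ∂(Measure.infinitePi fun _ : ι ↦ gaussianReal 0 1) = 0 ∧
      variance (fun x : ι → ℝ ↦ ∑ i ∈ s, y i * x i)
        (Measure.infinitePi fun _ : ι ↦ gaussianReal 0 1) = ∑ i ∈ s, y i ^ 2 := by
  have hmp (i : ι) := measurePreserving_eval_infinitePi (fun _ : ι ↦ gaussianReal 0 1) i
  have hL (i : ι) : MemLp (fun x : ι → ℝ ↦ x i) 2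
      (Measure.infinitePi fun _ : ι ↦ gaussianReal 0 1) :=
    (memLp_id_gaussianReal (μ := 0) (v := 1) 2).comp_measurePreserving (hmp i)
  have hLy (i : ι) : MemLp (fun x : ι → ℝ ↦ y i * x i) 2
      (Measure.infinitePi fun _ : ι ↦ gaussianReal 0 1) := (hL i).const_mul (y i)
  refine ⟨memLp_finsetSum s fun i _ ↦ hLy i, ?_, ?_⟩
  · rw [integral_finsetSum _ fun i _ ↦ (hLy i).integrable one_le_two]
    refine Finset.sum_eq_zero fun i _ ↦ ?_
    rw [integral_const_mul]
    have : ∫ x : ι → ℝ, x i ∂(Measure.infinitePi fun _ : ι ↦ gaussianReal 0 1) =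
        ∫ x, x ∂gaussianReal 0 1 :=
      ((integral_map (measurable_pi_apply i).aemeasurable aestronglyMeasurable_id).symm.trans
        (by rw [(hmp i).map_eq]))
    rw [this, integral_id_gaussianReal, mul_zero]
  · have hsum : (fun x : ι → ℝ ↦ ∑ i ∈ s, y i * x i) =
        ∑ i ∈ s, fun x : ι → ℝ ↦ y i * x i := by ext x; simp
    rw [hsum, IndepFun.variance_sum fun i _ ↦ hLy i]
    · refine Finset.sum_congr rfl fun i _ ↦ ?_
      rw [variance_const_mul]
      have : variance (fun x : ι → ℝ ↦ x i) (Measure.infinitePi fun _ : ι ↦ gaussianReal 0 1) =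
          variance id (gaussianReal 0 1) :=
        (variance_map aemeasurable_id (hmp i).measurable.aemeasurable).symm.trans
          (by rw [(hmp i).map_eq])
      rw [this, variance_id_gaussianReal]
      simp
    · intro i _ j _ hij
      exact (iIndepFun_infinitePi (P := fun _ : ι ↦ gaussianReal 0 1) (X := fun i x ↦ y i * x)
        fun i ↦ by fun_prop).indepFun hij

lemma infinitePi_gaussianReal_half_le_abs_sum_mul_le {ι : Type*} (y : ι → ℝ) (s : Finset ι)
    (hs : 0 < ∑ i ∈ s, y i ^ 2) :
    (Measure.infinitePi fun _ : ι ↦ gaussianReal 0 1)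
      {x | (∑ i ∈ s, y i ^ 2) / 2 ≤ |∑ i ∈ s, y i * x i|} ≤
        ENNReal.ofReal (4 / ∑ i ∈ s, y i ^ 2) := by
  obtain ⟨hL, hmean, hvar⟩ := variance_sum_mul_infinitePi_gaussianReal y s
  have := meas_ge_le_variance_div_sq hL (half_pos hs)
  rw [hmean, hvar] at this
  simp only [sub_zero] at this
  convert this using 2
  field_simp
  norm_num

lemma infinitePi_gaussianReal_map_add_mutuallySingular {ι : Type*} {y : ι → ℝ}
    (hy : ¬ Summable fun i ↦ y i ^ 2) :
    ((Measure.infinitePi fun _ : ι ↦ gaussianReal 0 1).map fun x ↦ x + y).MutuallySingular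
      (Measure.infinitePi fun _ : ι ↦ gaussianReal 0 1) := by
  have hadd : Measurable fun x : ι → ℝ ↦ x + y := by fun_prop
  have : IsProbabilityMeasure
      ((Measure.infinitePi fun _ : ι ↦ gaussianReal 0 1).map fun x ↦ x + y) :=
    Measure.isProbabilityMeasure_map hadd.aemeasurable
  refine mutuallySingular_of_forall_exists_measure_add_compl_le fun ε hε ↦ ?_
  obtain ⟨δ, hδ, hδε⟩ : ∃ δ : ℝ, 0 < δ ∧ ENNReal.ofReal δ ≤ ε := by
    obtain ⟨r, hr, hrε⟩ := ENNReal.lt_iff_exists_nnreal_btwn.1 hε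
    exact ⟨r, by exact_mod_cast hr, by simpa using hrε.le⟩
  obtain ⟨s, hs⟩ : ∃ s : Finset ι, 8 / δ < ∑ i ∈ s, y i ^ 2 := by
    by_contra! h
    exact hy (summable_of_sum_le (fun i ↦ sq_nonneg _) h)
  have hpos : 0 < ∑ i ∈ s, y i ^ 2 := (by positivity : 0 < 8 / δ).trans hs
  have htail := infinitePi_gaussianReal_half_le_abs_sum_mul_le y s hpos
  refine ⟨{x | ∑ i ∈ s, y i * x i < (∑ i ∈ s, y i ^ 2) / 2}, ?_⟩
  rw [Measure.map_apply hadd (measurableSet_lt (by fun_prop) measurable_const)]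
  refine (add_le_add ((measure_mono ?_).trans htail) ((measure_mono ?_).trans htail)).trans ?_
  · intro x hx
    have hx : ∑ i ∈ s, y i * (x i + y i) < (∑ i ∈ s, y i ^ 2) / 2 := hx
    simp_rw [mul_add, Finset.sum_add_distrib, ← sq] at hx
    have : (∑ i ∈ s, y i ^ 2) / 2 ≤ -∑ i ∈ s, y i * x i := by linarith
    exact le_abs.2 (Or.inr this)
  · intro x hx
    simp only [Set.mem_compl_iff, Set.mem_ofPred_eq, not_lt] at hx
    exact le_abs.2 (Or.inl hx)
  · rw [← ENNReal.ofReal_add (by positivity) (by positivity)]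
    refine (ENNReal.ofReal_le_ofReal ?_).trans hδε
    rw [div_lt_iff₀ hδ] at hs
    rw [← add_div, div_le_iff₀ hpos]
    linarith

lemma eq_infinitePi_of_forall_fin {X : ℕ → Type*} [∀ i, MeasurableSpace (X i)]
    (P : (i : ℕ) → Measure (X i)) [∀ i, IsProbabilityMeasure (P i)] {μ : Measure ((i : ℕ) → X i)}
    (hμ : ∀ (n : ℕ) (A : (i : Fin n) → Set (X i)), (∀ i, MeasurableSet (A i)) →
      μ {x | ∀ i : Fin n, x i ∈ A i} = ∏ i : Fin n, P i (A i)) :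
    μ = Measure.infinitePi P := by
  classical
  refine Measure.eq_infinitePi _ fun s t ht ↦ ?_
  obtain ⟨n, hn⟩ := s.exists_nat_subset_range
  have := hμ n (fun i ↦ if (i : ℕ) ∈ s then t i else Set.univ) fun i ↦ by
    split_ifs
    exacts [ht i, .univ]
  rw [Fin.prod_univ_eq_prod_range (fun i ↦ P i (if i ∈ s then t i else Set.univ)) n] at this
  rw [← Finset.prod_subset hn fun i _ hi ↦ by simp [hi]] at this
  rw [Finset.prod_congr rfl fun i hi ↦ by rw [if_pos hi]] at this
  rw [← this]
  congr 1
  ext x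
  simp only [Set.mem_pi, Finset.mem_coe, Set.mem_ofPred_eq]
  refine ⟨fun h i ↦ ?_, fun h i hi ↦ ?_⟩
  · split_ifs with hi
    exacts [h i hi, trivial]
  · simpa [hi] using h ⟨i, Finset.mem_range.1 (hn hi)⟩

/-- **Cameron–Martin theorem for the product Gaussian measure on `ℝ^ℕ`.**
Let `μ` be the countable product of standard Gaussian measures `N(0,1)` on `ℕ → ℝ`
(characterized on cylinder sets). Then for `h ∈ ℓ²`, the translated measure
`μ_h (A) = μ (A - h)` (i.e. the pushforward of `μ` under `x ↦ x + h`) and `μ` are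
mutually absolutely continuous, while for `y ∉ ℓ²` they are mutually singular. -/
theorem cameron_martin_product_gaussian
    (μ : Measure (ℕ → ℝ)) [IsProbabilityMeasure μ]
    (hcyl : ∀ (n : ℕ) (A : Fin n → Set ℝ), (∀ i, MeasurableSet (A i)) →
      μ {x : ℕ → ℝ | ∀ i : Fin n, x (i : ℕ) ∈ A i} = ∏ i, gaussianReal 0 1 (A i)) :
    (∀ h : ℕ → ℝ, Summable (fun i => (h i) ^ 2) →
      (μ.map (fun x => x + h) ≪ μ ∧ μ ≪ μ.map (fun x => x + h))) ∧
    (∀ y : ℕ → ℝ, ¬ Summable (fun i => (y i) ^ 2) →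
      (μ.map (fun x => x + y)).MutuallySingular μ) := by
  obtain rfl := eq_infinitePi_of_forall_fin (fun _ ↦ gaussianReal 0 1) hcyl
  refine ⟨fun h hh ↦ ?_, fun y hy ↦ infinitePi_gaussianReal_map_add_mutuallySingular hy⟩
  have hac (g : ℕ → ℝ) (hg : Summable fun i ↦ g i ^ 2) :
      (Measure.infinitePi fun _ : ℕ ↦ gaussianReal 0 1).map (fun x ↦ x + g) ≪
        Measure.infinitePi fun _ : ℕ ↦ gaussianReal 0 1 := by
    rw [infinitePi_gaussianReal_map_add]
    exact infinitePi_gaussianReal_absolutelyContinuous hg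
  refine ⟨hac h hh, ?_⟩
  have hadd (g : ℕ → ℝ) : Measurable fun x : ℕ → ℝ ↦ x + g := by fun_prop
  have hneg := (hac (-h) (by simpa using hh)).map (hadd h)
  rw [Measure.map_map (hadd h) (hadd (-h))] at hneg
  simpa [Function.comp_def] using hneg
end

section
/- Let W be a separable Banach space. Then there exists a non-degenerate Gaussian measure on W: a Borel probability measure μ such that every f ∈ W* is a centered Gaussian random variable under μ, and such that ∫_W f(x)² μ(dx) > 0 for every nonzero f ∈ W*. -/
open MeasureTheory ProbabilityTheory
open scoped NNReal ENNReal

open Filter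
open scoped Topology

section GaussianSeries

variable {Ω : Type*} [MeasurableSpace Ω] {P : Measure Ω} {ξ : ℕ → Ω → ℝ}

/-- The characteristic function of a finite linear combination of independent standard Gaussian
variables is that of a centered Gaussian with variance `∑ i ∈ s, a i ^ 2`. -/
lemma charFun_map_sum_mul_of_iIndepFun_gaussianReal
    (hξ : ∀ n, HasLaw (ξ n) (gaussianReal 0 1) P) (hind : iIndepFun ξ P) (a : ℕ → ℝ)
    (s : Finset ℕ) (t : ℝ) :
    charFun (P.map fun ω ↦ ∑ i ∈ s, a i * ξ i ω) t
      = Complex.exp (-((∑ i ∈ s, a i ^ 2 : ℝ) * t ^ 2 / 2)) := by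
  have hind' : iIndepFun (fun i ω ↦ a i * ξ i ω) P :=
    hind.comp (fun i x ↦ a i * x) fun i ↦ by fun_prop
  rw [(hind'.restrict _).charFun_map_fun_finsetSum_eq_prod
    fun i _ ↦ (hξ i).aemeasurable.const_mul _, Finset.prod_apply]
  simp_rw [(gaussianReal_const_mul (hξ _) (a _)).map_eq, charFun_gaussianReal]
  rw [← Complex.exp_sum]
  congr 1
  push_cast
  rw [Finset.sum_mul, Finset.sum_div, ← Finset.sum_neg_distrib]
  exact Finset.sum_congr rfl fun i _ ↦ by simp

/-- An almost surely convergent series of independent centered Gaussian variables with summable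
variances is centered Gaussian, and its variance is the sum of the variances. -/
lemma map_eq_gaussianReal_of_hasSum [IsProbabilityMeasure P]
    (hξ : ∀ n, HasLaw (ξ n) (gaussianReal 0 1) P) (hind : iIndepFun ξ P) {a : ℕ → ℝ}
    (ha : Summable fun n ↦ a n ^ 2) {Y : Ω → ℝ}
    (hY : ∀ᵐ ω ∂P, HasSum (fun n ↦ a n * ξ n ω) (Y ω)) :
    P.map Y = gaussianReal 0 (∑' n, a n ^ 2).toNNReal := by
  have hS (s : Finset ℕ) : AEMeasurable (fun ω ↦ ∑ i ∈ s, a i * ξ i ω) P :=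
    Finset.aemeasurable_fun_sum _ fun i _ ↦ (hξ i).aemeasurable.const_mul _
  have hYm : AEMeasurable Y P := aemeasurable_of_tendsto_metrizable_ae atTop
    (fun n ↦ hS (Finset.range n)) (hY.mono fun ω h ↦ h.tendsto_sum_nat)
  have := Measure.isProbabilityMeasure_map hYm
  refine Measure.ext_of_charFun (funext fun t ↦ ?_)
  have hlim : Tendsto (fun n ↦ charFun (P.map fun ω ↦ ∑ i ∈ Finset.range n, a i * ξ i ω) t)
      atTop (𝓝 (charFun (P.map Y) t)) := by
    simp_rw [charFun_apply_real]
    rw [integral_map hYm (by fun_prop)]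
    simp_rw [fun n ↦ integral_map (hS (Finset.range n))
      (f := fun x : ℝ ↦ Complex.exp (t * x * Complex.I)) (by fun_prop)]
    refine tendsto_integral_of_dominated_convergence (fun _ ↦ 1) (fun n ↦ ?_)
      (integrable_const 1) (fun n ↦ ae_of_all _ fun ω ↦ ?_) (hY.mono fun ω h ↦ ?_)
    · have := hS (Finset.range n)
      exact AEMeasurable.aestronglyMeasurable (by fun_prop)
    · rw [← Complex.ofReal_mul, Complex.norm_exp_ofReal_mul_I]
    · have hc : Continuous fun x : ℝ ↦ Complex.exp (t * x * Complex.I) := by fun_prop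
      exact (hc.tendsto _).comp h.tendsto_sum_nat
  refine tendsto_nhds_unique hlim ?_
  simp_rw [charFun_map_sum_mul_of_iIndepFun_gaussianReal hξ hind]
  rw [charFun_gaussianReal, Real.coe_toNNReal _ (tsum_nonneg fun n ↦ sq_nonneg (a n)),
    Complex.ofReal_zero, mul_zero, zero_mul, zero_sub]
  have hc : Continuous fun x : ℝ ↦ Complex.exp (-(x * t ^ 2 / 2)) := by fun_prop
  exact (hc.tendsto _).comp ha.hasSum.tendsto_sum_nat

lemma ae_summable_smul_of_summable_norm {E : Type*} [NormedAddCommGroup E] [NormedSpace ℝ E]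
    [CompleteSpace E] (hξ : ∀ n, HasLaw (ξ n) (gaussianReal 0 1) P) {y : ℕ → E}
    (hy : Summable fun n ↦ ‖y n‖) :
    ∀ᵐ ω ∂P, Summable fun n ↦ ξ n ω • y n := by
  have hL (n : ℕ) : eLpNorm (ξ n) 1 P = eLpNorm id 1 (gaussianReal 0 1) := by
    rw [← (hξ n).map_eq, eLpNorm_map_measure (by fun_prop) (hξ n).aemeasurable, Function.id_comp]
  have hsum : ∑' n, eLpNorm (‖y n‖ • ξ n) 1 P ≠ ∞ := by
    simp_rw [eLpNorm_const_smul, hL, ENNReal.tsum_mul_right, enorm_norm]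
    exact ENNReal.mul_ne_top (tsum_enorm_ne_top_iff_summable_norm.2 hy)
      (memLp_id_gaussianReal 1).2.ne
  filter_upwards [summable_norm_of_tsum_eLpNorm_ne_top le_rfl
    (fun n ↦ ((hξ n).aemeasurable.const_smul ‖y n‖).aestronglyMeasurable) hsum] with ω hω
  refine Summable.of_norm (hω.congr fun n ↦ ?_)
  simp [norm_smul, mul_comm]

end GaussianSeries

/-- A separable normed space has a total sequence with summable norms. -/
lemma exists_summable_norm_forall_apply_eq_zero (E : Type*) [NormedAddCommGroup E]
    [NormedSpace ℝ E] [TopologicalSpace.SeparableSpace E] :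
    ∃ y : ℕ → E, (Summable fun n ↦ ‖y n‖) ∧
      ∀ f : E →L[ℝ] ℝ, (∀ n, f (y n) = 0) → f = 0 := by
  let x := TopologicalSpace.denseSeq E
  have hpos (n : ℕ) : 0 < 1 + ‖x n‖ := by positivity
  refine ⟨fun n ↦ ((1 / 2 : ℝ) ^ n / (1 + ‖x n‖)) • x n, ?_, fun f hf ↦ ?_⟩
  · refine summable_geometric_two.of_nonneg_of_le (fun n ↦ norm_nonneg _) fun n ↦ ?_
    rw [norm_smul, Real.norm_of_nonneg (by positivity), div_mul_eq_mul_div, div_le_iff₀ (hpos n)]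
    gcongr
    linarith
  · have h0 (n : ℕ) : f (x n) = 0 := by
      have := hf n
      rw [map_smul, smul_eq_zero] at this
      exact this.resolve_left (by have := hpos n; positivity)
    refine DFunLike.coe_injective ((TopologicalSpace.denseRange_denseSeq E).equalizer
      f.continuous continuous_const (funext h0))

/-- Every separable Banach space admits a non-degenerate Gaussian measure: a Gaussian
Borel probability measure whose covariance form `q(f,f) = ∫ (f x)² dμ` is positive
definite on `W*`. -/
theorem exists_nondegenerate_gaussian_measure
    (W : Type*) [NormedAddCommGroup W] [NormedSpace ℝ W] [CompleteSpace W]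
    [SecondCountableTopology W] [MeasurableSpace W] [BorelSpace W] :
    ∃ μ : Measure W, IsGaussianMeasure μ ∧
      ∀ f : W →L[ℝ] ℝ, f ≠ 0 → 0 < ∫ x, (f x) ^ 2 ∂μ := by
  obtain ⟨y, hy, hy0⟩ := exists_summable_norm_forall_apply_eq_zero W
  let P : Measure (ℕ → ℝ) := Measure.infinitePi fun _ ↦ gaussianReal 0 1
  let ξ : ℕ → (ℕ → ℝ) → ℝ := fun n ω ↦ ω n
  have hξ (n : ℕ) : HasLaw (ξ n) (gaussianReal 0 1) P :=
    (measurePreserving_eval_infinitePi (fun _ ↦ gaussianReal 0 1) n).hasLaw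
  have hind : iIndepFun ξ P := iIndepFun_infinitePi (X := fun _ x ↦ x) fun _ ↦ measurable_id
  let X : (ℕ → ℝ) → W := fun ω ↦ ∑' n, ξ n ω • y n
  have hX : ∀ᵐ ω ∂P, HasSum (fun n ↦ ξ n ω • y n) (X ω) :=
    (ae_summable_smul_of_summable_norm hξ hy).mono fun ω h ↦ h.hasSum
  have hXm : AEMeasurable X P := by
    refine aemeasurable_of_tendsto_metrizable_ae atTop
      (f := fun n ω ↦ ∑ i ∈ Finset.range n, ξ i ω • y i) (fun n ↦ ?_)
      (hX.mono fun ω h ↦ h.tendsto_sum_nat)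
    exact Finset.aemeasurable_fun_sum _ fun i _ ↦ (hξ i).aemeasurable.smul_const _
  have hsq (f : W →L[ℝ] ℝ) : Summable fun n ↦ f (y n) ^ 2 := by
    have hf : Summable fun n ↦ ‖f (y n)‖ :=
      (hy.mul_left ‖f‖).of_nonneg_of_le (fun n ↦ norm_nonneg _) fun n ↦ f.le_opNorm _
    refine (hf.mul_left (∑' n, ‖f (y n)‖)).of_nonneg_of_le (fun n ↦ sq_nonneg _) fun n ↦ ?_
    rw [← sq_abs, sq, ← Real.norm_eq_abs]
    gcongr
    exact hf.le_tsum n fun _ _ ↦ norm_nonneg _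
  have hmap (f : W →L[ℝ] ℝ) :
      (P.map X).map f = gaussianReal 0 (∑' n, f (y n) ^ 2).toNNReal := by
    rw [AEMeasurable.map_map_of_aemeasurable (by fun_prop) hXm]
    refine map_eq_gaussianReal_of_hasSum hξ hind (hsq f) (hX.mono fun ω h ↦ ?_)
    simpa [mul_comm] using f.hasSum h
  refine ⟨P.map X, ⟨Measure.isProbabilityMeasure_map hXm, fun f ↦ ⟨_, hmap f⟩⟩, fun f hf ↦ ?_⟩
  have hint : ∫ x, f x ^ 2 ∂(P.map X) = ∑' n, f (y n) ^ 2 := by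
    rw [← integral_map (φ := f) (f := fun x : ℝ ↦ x ^ 2) (by fun_prop) (by fun_prop), hmap f,
      ← variance_of_integral_eq_zero aemeasurable_id' integral_id_gaussianReal,
      variance_fun_id_gaussianReal, Real.coe_toNNReal _ (tsum_nonneg fun n ↦ sq_nonneg _)]
  obtain ⟨n, hn⟩ : ∃ n, f (y n) ≠ 0 := by
    contrapose! hf
    exact hy0 f hf
  rw [hint]
  exact (hsq f).tsum_pos (fun n ↦ sq_nonneg _) n (by positivity)
end

section
/- (Gaussian Poincaré inequality for cylinder functions) Let μ be a Gaussian measure on a separable Banach space W with covariance form q(f,g) = ∫_W f(x) g(x) μ(dx), and let f_1, ..., f_n ∈ W* be q-orthonormal, i.e. q(f_i, f_j) = δ_{ij}. Let φ : ℝⁿ → ℝ be a smooth compactly supported function and define the cylinder function F(x) = φ(f_1(x), ..., f_n(x)). Then ∫_W |F(x) − ∫_W F dμ|² μ(dx) ≤ ∫_W ∑_{i=1}^n |∂_i φ(f_1(x), ..., f_n(x))|² μ(dx). -/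
open MeasureTheory ProbabilityTheory
open scoped NNReal ENNReal

/-- **Stein's identity** for the standard Gaussian measure on the real line. -/
lemma integral_id_mul_gaussianReal {g g' : ℝ → ℝ} {C K : ℝ}
    (hg : ∀ t, HasDerivAt g (g' t) t) (hg' : Continuous g')
    (hC : ∀ t, |g t| ≤ C) (hK : ∀ t, |g' t| ≤ K) :
    ∫ t, t * g t ∂(gaussianReal 0 1) = ∫ t, g' t ∂(gaussianReal 0 1) := by
  have hgc : Continuous g := continuous_iff_continuousAt.2 fun t => (hg t).continuousAt
  have hp : ∀ t, HasDerivAt (gaussianPDFReal 0 1) (-t * gaussianPDFReal 0 1 t) t := by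
    intro t
    have h1 : HasDerivAt (fun s : ℝ => -s ^ 2 / 2) (-t) t := by
      have := ((hasDerivAt_pow 2 t).neg).div_const 2
      convert! this using 1
      norm_num
      ring
    have h2 := (h1.exp).const_mul (√(2 * Real.pi))⁻¹
    have h3 : gaussianPDFReal 0 1 = fun s : ℝ => (√(2 * Real.pi))⁻¹ * Real.exp (-s ^ 2 / 2) := by
      ext s; simp [gaussianPDFReal]
    rw [h3]
    convert! h2 using 1
    ring
  have hint : ∀ {u : ℝ → ℝ}, Integrable u (gaussianReal 0 1) →
      Integrable (fun t => u t * gaussianPDFReal 0 1 t) := by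
    intro u hu
    rw [gaussianReal_of_var_ne_zero _ one_ne_zero, integrable_withDensity_iff_integrable_smul'
      (measurable_gaussianPDF 0 1) (ae_of_all _ fun _ => gaussianPDF_lt_top)] at hu
    simpa [toReal_gaussianPDF, mul_comm] using hu
  have hig : Integrable g (gaussianReal 0 1) :=
    Integrable.of_bound hgc.aestronglyMeasurable C (ae_of_all _ hC)
  have hig' : Integrable g' (gaussianReal 0 1) :=
    Integrable.of_bound hg'.aestronglyMeasurable K (ae_of_all _ hK)
  have hid : Integrable (fun t : ℝ => t) (gaussianReal 0 1) := IsGaussian.integrable_id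
  have hitg : Integrable (fun t => t * g t) (gaussianReal 0 1) :=
    hid.mul_bdd (c := C) hgc.aestronglyMeasurable (ae_of_all _ hC)
  have hdiff : ∀ t, HasDerivAt (fun s => g s * gaussianPDFReal 0 1 s)
      ((g' t - t * g t) * gaussianPDFReal 0 1 t) t := by
    intro t
    convert! (hg t).mul (hp t) using 1
    ring
  have hzero := integral_eq_zero_of_hasDerivAt_of_integrable hdiff (hint (hig'.sub hitg)) (hint hig)
  have : ∫ t, (g' t - t * g t) ∂(gaussianReal 0 1) = 0 := by
    rw [integral_gaussianReal_eq_integral_smul one_ne_zero]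
    simpa [mul_comm] using hzero
  rw [integral_sub hig' hitg] at this
  linarith

section StandardGaussian

variable {n : ℕ}

instance isGaussian_pi_gaussianReal :
    IsGaussian (Measure.pi fun _ : Fin n => gaussianReal 0 1) := by
  have h : iIndepFun (fun (i : Fin n) (ω : Fin n → ℝ) => ω i)
      (Measure.pi fun _ : Fin n => gaussianReal 0 1) :=
    iIndepFun_pi (μ := fun _ : Fin n => gaussianReal 0 1) (X := fun _ x => x)
      fun _ => aemeasurable_id
  have h2 := h.hasGaussianLaw fun i => ⟨by
    rw [show (fun ω : Fin n → ℝ => ω i) = Function.eval i from rfl,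
      (measurePreserving_eval (fun _ : Fin n => gaussianReal 0 1) i).map_eq]
    infer_instance⟩
  simpa using h2.isGaussian_map

lemma integral_id_pi_gaussianReal :
    (Measure.pi fun _ : Fin n => gaussianReal 0 1)[id] = 0 := by
  ext i
  have h := IsGaussian.integral_dual (μ := Measure.pi fun _ : Fin n => gaussianReal 0 1)
    (ContinuousLinearMap.proj (R := ℝ) (φ := fun _ : Fin n => ℝ) i)
  have h2 := integral_map (μ := Measure.pi fun _ : Fin n => gaussianReal 0 1)
    (φ := Function.eval i) (measurable_pi_apply i).aemeasurable (f := fun x : ℝ => x) (by fun_prop)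
  rw [(measurePreserving_eval (fun _ : Fin n => gaussianReal 0 1) i).map_eq] at h2
  rw [integral_id_gaussianReal] at h2
  exact h.symm.trans h2.symm

/-- **Stein's identity** in one coordinate of the standard Gaussian measure on `ℝⁿ`. -/
lemma integral_eval_mul_pi_gaussianReal {g : (Fin n → ℝ) → ℝ} {C K : ℝ}
    (hg : ContDiff ℝ 1 g) (hC : ∀ x, |g x| ≤ C) (hK : ∀ x, ‖fderiv ℝ g x‖ ≤ K) (i : Fin n) :
    ∫ x, x i * g x ∂(Measure.pi fun _ : Fin n => gaussianReal 0 1) =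
      ∫ x, fderiv ℝ g x (Pi.single i 1) ∂(Measure.pi fun _ : Fin n => gaussianReal 0 1) := by
  cases n with
  | zero => exact i.elim0
  | succ m =>
    have hfc : Continuous fun x => fderiv ℝ g x (Pi.single i 1) :=
      (hg.continuous_fderiv one_ne_zero).clm_apply continuous_const
    have hb : ∀ x, |fderiv ℝ g x (Pi.single i 1)| ≤ K := fun x => by
      simpa [Pi.norm_single] using (fderiv ℝ g x).le_of_opNorm_le (hK x) (Pi.single i 1)
    have hi1 : Integrable (fun x : Fin (m + 1) → ℝ => x i * g x)
        (Measure.pi fun _ : Fin (m + 1) => gaussianReal 0 1) :=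
      (IsGaussian.integrable_dual _
        (ContinuousLinearMap.proj (R := ℝ) (φ := fun _ : Fin (m + 1) => ℝ) i)).mul_bdd (c := C)
        hg.continuous.aestronglyMeasurable (ae_of_all _ hC)
    have hi2 : Integrable (fun x => fderiv ℝ g x (Pi.single i 1))
        (Measure.pi fun _ : Fin (m + 1) => gaussianReal 0 1) :=
      Integrable.of_bound hfc.aestronglyMeasurable K (ae_of_all _ hb)
    have hmp := (measurePreserving_piFinSuccAbove (fun _ : Fin (m + 1) => gaussianReal 0 1) i).symm
    rw [← hmp.integral_comp', ← hmp.integral_comp']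
    refine (integral_prod_symm _ ((hmp.integrable_comp_emb
      (MeasurableEquiv.measurableEmbedding _)).2 hi1)).trans (.trans ?_ (integral_prod_symm _
      ((hmp.integrable_comp_emb (MeasurableEquiv.measurableEmbedding _)).2 hi2)).symm)
    congr 1
    ext y
    simp only [Function.comp_apply, MeasurableEquiv.piFinSuccAbove_symm_apply, Fin.insertNthEquiv, Equiv.coe_fn_mk,
      Fin.insertNth_apply_same]
    have hupd : ∀ t : ℝ, (i.insertNth t y : Fin (m + 1) → ℝ) =
        Function.update (i.insertNth 0 y : Fin (m + 1) → ℝ) i t := fun t => by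
      rw [Fin.update_insertNth]
    have hcont : Continuous fun t : ℝ => (i.insertNth t y : Fin (m + 1) → ℝ) := by
      rw [funext hupd]; fun_prop
    refine integral_id_mul_gaussianReal (C := C) (K := K) (fun t => ?_) (hfc.comp hcont)
      (fun t => hC _) (fun t => hb _)
    have hd := hasDerivAt_update (i.insertNth 0 y : Fin (m + 1) → ℝ) i t
    rw [← funext hupd] at hd
    exact ((hg.differentiable one_ne_zero _).hasFDerivAt).comp_hasDerivAt t hd

/-- Gaussian integration by parts for the derivative along the rotation flow. -/
lemma integral_mul_fderiv_rotation {g : (Fin n → ℝ) → ℝ} {C K : ℝ}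
    (hg : ContDiff ℝ 1 g) (hC : ∀ x, |g x| ≤ C) (hK : ∀ x, ‖fderiv ℝ g x‖ ≤ K) (θ : ℝ) :
    ∫ p, g p.1 * fderiv ℝ g (Real.cos θ • p.1 + Real.sin θ • p.2)
        (-Real.sin θ • p.1 + Real.cos θ • p.2)
      ∂((Measure.pi fun _ : Fin n => gaussianReal 0 1).prod
        (Measure.pi fun _ : Fin n => gaussianReal 0 1)) =
    -Real.sin θ * ∫ p, ∑ i, fderiv ℝ g p.1 (Pi.single i 1) *
        fderiv ℝ g (Real.cos θ • p.1 - Real.sin θ • p.2) (Pi.single i 1)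
      ∂((Measure.pi fun _ : Fin n => gaussianReal 0 1).prod
        (Measure.pi fun _ : Fin n => gaussianReal 0 1)) := by
  set ν := Measure.pi fun _ : Fin n => gaussianReal 0 1
  have hC0 : 0 ≤ C := (abs_nonneg _).trans (hC 0)
  have hK0 : 0 ≤ K := (norm_nonneg _).trans (hK 0)
  have hgc := hg.continuous
  have hDc := hg.continuous_fderiv one_ne_zero
  have hb : ∀ x i, |fderiv ℝ g x (Pi.single i 1)| ≤ K := fun x i => by
    simpa [Pi.norm_single] using (fderiv ℝ g x).le_of_opNorm_le (hK x) (Pi.single i 1)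
  have hQc : Continuous fun p : (Fin n → ℝ) × (Fin n → ℝ) =>
      g (Real.cos θ • p.1 - Real.sin θ • p.2) * fderiv ℝ g p.1 p.2 := by fun_prop
  have hnorm : Integrable (fun p : (Fin n → ℝ) × (Fin n → ℝ) => ‖p.2‖) (ν.prod ν) :=
    (IsGaussian.integrable_id (μ := ν)).norm.comp_snd ν
  have hQi : Integrable (fun p : (Fin n → ℝ) × (Fin n → ℝ) =>
      g (Real.cos θ • p.1 - Real.sin θ • p.2) * fderiv ℝ g p.1 p.2) (ν.prod ν) := by
    refine (hnorm.const_mul (C * K)).mono' hQc.aestronglyMeasurable (ae_of_all _ fun p => ?_)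
    rw [norm_mul, mul_assoc]
    exact mul_le_mul (hC _) ((fderiv ℝ g p.1).le_of_opNorm_le (hK _) _) (norm_nonneg _) hC0
  have hSi : Integrable (fun p : (Fin n → ℝ) × (Fin n → ℝ) =>
      ∑ i, fderiv ℝ g p.1 (Pi.single i 1) *
        fderiv ℝ g (Real.cos θ • p.1 - Real.sin θ • p.2) (Pi.single i 1)) (ν.prod ν) := by
    refine integrable_finsetSum _ fun i _ => Integrable.of_bound (C := K * K)
      (Continuous.aestronglyMeasurable (by fun_prop)) (ae_of_all _ fun p => ?_)
    rw [norm_mul]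
    exact mul_le_mul (hb _ _) (hb _ _) (norm_nonneg _) hK0
  have hrot := IsGaussian.map_rotation_eq_self (μ := ν) integral_id_pi_gaussianReal θ
  have h1 := integral_map (μ := ν.prod ν) (φ := ContinuousLinearMap.rotation θ) (by fun_prop)
    hQc.aestronglyMeasurable
  rw [hrot] at h1
  have h2 : ∀ p : (Fin n → ℝ) × (Fin n → ℝ),
      Real.cos θ • (Real.cos θ • p.1 + Real.sin θ • p.2) -
        Real.sin θ • (-Real.sin θ • p.1 + Real.cos θ • p.2) = p.1 := fun p => by
    ext i
    simp only [Pi.sub_apply, Pi.add_apply, Pi.smul_apply, smul_eq_mul]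
    linear_combination p.1 i * Real.sin_sq_add_cos_sq θ
  simp only [ContinuousLinearMap.rotation_apply, h2] at h1
  rw [← h1, integral_prod _ hQi, integral_prod _ hSi, ← integral_const_mul]
  congr 1
  ext u
  have hG : ContDiff ℝ 1 fun v => g (Real.cos θ • u - Real.sin θ • v) := by fun_prop
  have hGd : ∀ v, fderiv ℝ (fun v => g (Real.cos θ • u - Real.sin θ • v)) v =
      -Real.sin θ • fderiv ℝ g (Real.cos θ • u - Real.sin θ • v) := fun v => by
    have hi : HasFDerivAt (fun v : Fin n → ℝ => Real.cos θ • u - Real.sin θ • v)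
        (-(Real.sin θ • ContinuousLinearMap.id ℝ (Fin n → ℝ))) v :=
      ((hasFDerivAt_id v).const_smul (Real.sin θ)).const_sub _
    have := ((hg.differentiable one_ne_zero _).hasFDerivAt.comp v hi).fderiv
    refine this.trans ?_
    ext w
    simp
  have hstein := fun i => integral_eval_mul_pi_gaussianReal hG (fun v => hC _)
    (K := |Real.sin θ| * K) (fun v => by
      rw [hGd, norm_smul, norm_neg]
      exact mul_le_mul_of_nonneg_left (hK _) (abs_nonneg _)) i
  have hexp : ∀ v : Fin n → ℝ, fderiv ℝ g u v = ∑ i, fderiv ℝ g u (Pi.single i 1) * v i :=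
    fun v => by
      conv_lhs => rw [pi_eq_sum_univ' v]
      simp [map_sum, mul_comm]
  calc ∫ v, g (Real.cos θ • u - Real.sin θ • v) * fderiv ℝ g u v ∂ν
      = ∫ v, ∑ i, fderiv ℝ g u (Pi.single i 1) *
          (v i * g (Real.cos θ • u - Real.sin θ • v)) ∂ν := by
        congr 1; ext v
        rw [hexp, Finset.mul_sum]
        exact Finset.sum_congr rfl fun i _ => by ring
    _ = ∑ i, fderiv ℝ g u (Pi.single i 1) *
          ∫ v, v i * g (Real.cos θ • u - Real.sin θ • v) ∂ν := by
        rw [integral_finsetSum _ fun i _ => ?_]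
        · simp_rw [integral_const_mul]
        · exact ((IsGaussian.integrable_dual ν
            (ContinuousLinearMap.proj (R := ℝ) (φ := fun _ : Fin n => ℝ) i)).mul_bdd (c := C)
            hG.continuous.aestronglyMeasurable (ae_of_all _ fun v => hC _)).const_mul _
    _ = ∑ i, fderiv ℝ g u (Pi.single i 1) *
          ∫ v, -Real.sin θ *
            fderiv ℝ g (Real.cos θ • u - Real.sin θ • v) (Pi.single i 1) ∂ν := by
        refine Finset.sum_congr rfl fun i _ => ?_
        rw [hstein i]
        simp_rw [hGd]
        rfl
    _ = -Real.sin θ * ∫ v, ∑ i, fderiv ℝ g u (Pi.single i 1) *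
          fderiv ℝ g (Real.cos θ • u - Real.sin θ • v) (Pi.single i 1) ∂ν := by
        rw [integral_finsetSum _ fun i _ => ?_, Finset.mul_sum]
        · refine Finset.sum_congr rfl fun i _ => ?_
          rw [integral_const_mul, integral_const_mul]
          ring
        · exact (Integrable.of_bound (C := K) (Continuous.aestronglyMeasurable (by fun_prop))
            (ae_of_all _ fun v => hb _ _)).const_mul _

/-- **Gaussian Poincaré inequality** for the standard Gaussian measure on `ℝⁿ`. -/
theorem variance_pi_gaussianReal_le {g : (Fin n → ℝ) → ℝ} {C K : ℝ}
    (hg : ContDiff ℝ 1 g) (hC : ∀ x, |g x| ≤ C) (hK : ∀ x, ‖fderiv ℝ g x‖ ≤ K) :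
    Var[g; Measure.pi fun _ : Fin n => gaussianReal 0 1] ≤
      ∫ x, ∑ i, (fderiv ℝ g x (Pi.single i 1)) ^ 2
        ∂(Measure.pi fun _ : Fin n => gaussianReal 0 1) := by
  set ν := Measure.pi fun _ : Fin n => gaussianReal 0 1
  have hC0 : 0 ≤ C := (abs_nonneg _).trans (hC 0)
  have hK0 : 0 ≤ K := (norm_nonneg _).trans (hK 0)
  have hgc := hg.continuous
  have hDc := hg.continuous_fderiv one_ne_zero
  have hb : ∀ x i, |fderiv ℝ g x (Pi.single i 1)| ≤ K := fun x i => by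
    simpa [Pi.norm_single] using (fderiv ℝ g x).le_of_opNorm_le (hK x) (Pi.single i 1)
  set E : (Fin n → ℝ) → ℝ := fun x => ∑ i, (fderiv ℝ g x (Pi.single i 1)) ^ 2 with hE
  have hEc : Continuous E := by fun_prop
  have hE0 : ∀ x, 0 ≤ E x := fun x => Finset.sum_nonneg fun i _ => sq_nonneg _
  have hEb : ∀ x, ‖E x‖ ≤ ∑ _i : Fin n, K ^ 2 := fun x => by
    rw [Real.norm_of_nonneg (hE0 x)]
    exact Finset.sum_le_sum fun i _ => sq_le_sq' (abs_le.1 (hb x i)).1 (abs_le.1 (hb x i)).2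
  set A := ∫ x, E x ∂ν with hA
  set h : ℝ → ℝ := fun θ =>
    ∫ p, g p.1 * g (Real.cos θ • p.1 + Real.sin θ • p.2) ∂(ν.prod ν) with hh
  set k : ℝ → ℝ := fun θ => ∫ p, ∑ i, fderiv ℝ g p.1 (Pi.single i 1) *
    fderiv ℝ g (Real.cos θ • p.1 - Real.sin θ • p.2) (Pi.single i 1) ∂(ν.prod ν) with hk
  have hderiv : ∀ θ, HasDerivAt h (-Real.sin θ * k θ) θ := by
    intro θ
    rw [hk]
    beta_reduce
    rw [← integral_mul_fderiv_rotation hg hC hK θ]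
    have hbound : Integrable (fun p : (Fin n → ℝ) × (Fin n → ℝ) =>
        C * (K * (‖p.1‖ + ‖p.2‖))) (ν.prod ν) :=
      (((IsGaussian.integrable_id (μ := ν)).norm.comp_fst ν).add
        ((IsGaussian.integrable_id (μ := ν)).norm.comp_snd ν)).const_mul K |>.const_mul C
    refine (hasDerivAt_integral_of_dominated_loc_of_deriv_le (s := Set.univ) Filter.univ_mem
      (F := fun θ p => g p.1 * g (Real.cos θ • p.1 + Real.sin θ • p.2))
      (F' := fun θ p => g p.1 * fderiv ℝ g (Real.cos θ • p.1 + Real.sin θ • p.2)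
        (-Real.sin θ • p.1 + Real.cos θ • p.2))
      (Filter.Eventually.of_forall fun t => Continuous.aestronglyMeasurable (by fun_prop))
      (Integrable.of_bound (C := C * C) (Continuous.aestronglyMeasurable (by fun_prop))
        (ae_of_all _ fun p => ?_)) (Continuous.aestronglyMeasurable (by fun_prop))
      (ae_of_all _ fun p t _ => ?_) hbound (ae_of_all _ fun p t _ => ?_)).2
    · rw [norm_mul]
      exact mul_le_mul (hC _) (hC _) (norm_nonneg _) hC0
    · rw [norm_mul]
      refine mul_le_mul (hC _) (((fderiv ℝ g _).le_of_opNorm_le (hK _) _).trans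
        (mul_le_mul_of_nonneg_left ((norm_add_le _ _).trans (add_le_add ?_ ?_)) hK0))
        (norm_nonneg _) hC0
      · rw [norm_smul, norm_neg]
        exact mul_le_of_le_one_left (norm_nonneg _) (Real.abs_sin_le_one t)
      · rw [norm_smul]
        exact mul_le_of_le_one_left (norm_nonneg _) (Real.abs_cos_le_one t)
    · exact ((hg.differentiable one_ne_zero _).hasFDerivAt.comp_hasDerivAt t
        (((Real.hasDerivAt_cos t).smul_const p.1).add
          ((Real.hasDerivAt_sin t).smul_const p.2))).const_mul _
  have hkA : ∀ θ, k θ ≤ A := by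
    intro θ
    have hfst : ∫ p, E p.1 ∂(ν.prod ν) = A := by
      simp [integral_fun_fst, hA]
    have hrot := IsGaussian.map_rotation_eq_self (μ := ν) integral_id_pi_gaussianReal (-θ)
    have hrotE : ∫ p, E (Real.cos θ • p.1 - Real.sin θ • p.2) ∂(ν.prod ν) = A := by
      have h1 := integral_map (μ := ν.prod ν) (φ := ContinuousLinearMap.rotation (-θ))
        (by fun_prop) (f := fun p => E p.1) (by fun_prop)
      rw [hrot, hfst] at h1
      simpa [ContinuousLinearMap.rotation_apply, ← sub_eq_add_neg] using h1.symm
    have hi1 : Integrable (fun p : (Fin n → ℝ) × (Fin n → ℝ) => E p.1) (ν.prod ν) :=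
      Integrable.of_bound (Continuous.aestronglyMeasurable (by fun_prop)) _
        (ae_of_all _ fun p => hEb _)
    have hi2 : Integrable (fun p : (Fin n → ℝ) × (Fin n → ℝ) =>
        E (Real.cos θ • p.1 - Real.sin θ • p.2)) (ν.prod ν) :=
      Integrable.of_bound (Continuous.aestronglyMeasurable (by fun_prop)) _
        (ae_of_all _ fun p => hEb _)
    have hi3 : Integrable (fun p : (Fin n → ℝ) × (Fin n → ℝ) =>
        ∑ i, fderiv ℝ g p.1 (Pi.single i 1) *
          fderiv ℝ g (Real.cos θ • p.1 - Real.sin θ • p.2) (Pi.single i 1)) (ν.prod ν) := by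
      refine integrable_finsetSum _ fun i _ => Integrable.of_bound (C := K * K)
        (Continuous.aestronglyMeasurable (by fun_prop)) (ae_of_all _ fun p => ?_)
      rw [norm_mul]
      exact mul_le_mul (hb _ _) (hb _ _) (norm_nonneg _) hK0
    calc k θ ≤ ∫ p, (E p.1 + E (Real.cos θ • p.1 - Real.sin θ • p.2)) / 2 ∂(ν.prod ν) := by
          refine integral_mono hi3 ((hi1.add hi2).div_const 2) fun p => ?_
          simp only [hE]
          rw [← Finset.sum_add_distrib, Finset.sum_div]
          refine Finset.sum_le_sum fun i _ => ?_
          nlinarith [sq_nonneg (fderiv ℝ g p.1 (Pi.single i 1) -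
            fderiv ℝ g (Real.cos θ • p.1 - Real.sin θ • p.2) (Pi.single i 1))]
      _ = A := by
          rw [integral_div, integral_add hi1 hi2, hfst, hrotE]
          ring
  have hderiv' : ∀ θ, HasDerivAt (fun θ => h θ - A * Real.cos θ)
      (-Real.sin θ * k θ - A * -Real.sin θ) θ :=
    fun θ => (hderiv θ).sub ((Real.hasDerivAt_cos θ).const_mul A)
  have hmono : MonotoneOn (fun θ => h θ - A * Real.cos θ) (Set.Icc 0 (Real.pi / 2)) := by
    refine monotoneOn_of_deriv_nonneg (convex_Icc _ _)
      (fun θ _ => (hderiv' θ).continuousAt.continuousWithinAt)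
      (fun θ _ => (hderiv' θ).differentiableAt.differentiableWithinAt) fun θ hθ => ?_
    rw [interior_Icc] at hθ
    rw [(hderiv' θ).deriv]
    have hs : 0 ≤ Real.sin θ :=
      Real.sin_nonneg_of_nonneg_of_le_pi hθ.1.le (by linarith [hθ.2, Real.pi_pos])
    nlinarith [mul_nonneg hs (sub_nonneg.2 (hkA θ))]
  have hpi : (0 : ℝ) ≤ Real.pi / 2 := by positivity
  have hle := hmono (Set.left_mem_Icc.2 hpi) (Set.right_mem_Icc.2 hpi) hpi
  have h0 : h 0 = ∫ x, g x ^ 2 ∂ν := by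
    simp only [hh, Real.cos_zero, Real.sin_zero, one_smul, zero_smul, add_zero, ← sq]
    simp [integral_fun_fst (μ := ν) (ν := ν) (fun x => g x ^ 2)]
  have h1 : h (Real.pi / 2) = (∫ x, g x ∂ν) ^ 2 := by
    simp only [hh, Real.cos_pi_div_two, Real.sin_pi_div_two, one_smul, zero_smul, zero_add]
    rw [integral_prod_mul, sq]
  have hmem : MemLp g 2 ν :=
    MemLp.of_bound hgc.aestronglyMeasurable C (ae_of_all _ hC)
  rw [variance_eq_sub hmem]
  simp only [Real.cos_zero, Real.cos_pi_div_two, h0, h1] at hle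
  simp only [Pi.pow_apply]
  linarith

end StandardGaussian

/-- The joint law of covariance-orthonormal functionals is standard Gaussian. -/
lemma IsGaussianMeasure.map_eq_pi_gaussianReal
    {W : Type*} [NormedAddCommGroup W] [NormedSpace ℝ W] [CompleteSpace W]
    [SecondCountableTopology W] [MeasurableSpace W] [BorelSpace W]
    {μ : Measure W} (hμ : IsGaussianMeasure μ) {n : ℕ} {f : Fin n → W →L[ℝ] ℝ}
    (horth : ∀ i j, ∫ x, f i x * f j x ∂μ = if i = j then 1 else 0) :
    μ.map (fun x i => f i x) = Measure.pi fun _ : Fin n => gaussianReal 0 1 := by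
  obtain ⟨hprob, hgauss⟩ := hμ
  have hG : IsGaussian μ := isGaussian_of_map_eq_gaussianReal fun L => by
    obtain ⟨v, hv⟩ := hgauss L
    exact ⟨0, v, hv⟩
  have hmean : ∀ L : W →L[ℝ] ℝ, μ[L] = 0 := fun L => by
    obtain ⟨v, hv⟩ := hgauss L
    have := integral_map (μ := μ) (φ := L) (by fun_prop) (f := fun t : ℝ => t) (by fun_prop)
    rw [hv] at this
    simpa using this.symm
  have hmem : ∀ L : W →L[ℝ] ℝ, MemLp L 2 μ := fun L => IsGaussian.memLp_dual μ L 2 (by simp)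
  have hcov : ∀ i j, cov[f i, f j; μ] = if i = j then 1 else 0 := fun i j => by
    rw [covariance_eq_sub (hmem _) (hmem _), hmean, hmean, ← horth i j]
    simp
  have hlaw : HasGaussianLaw (fun ω => (fun i => f i ω)) μ :=
    ⟨inferInstanceAs (IsGaussian (μ.map (ContinuousLinearMap.pi f)))⟩
  have hind : iIndepFun (fun i => (f i : W → ℝ)) μ :=
    hlaw.iIndepFun_of_covariance_eq_zero fun i j hij => by simp [hcov, hij]
  rw [hind.map_fun_eq_pi_map fun i => by fun_prop]
  congr 1
  ext1 i
  obtain ⟨v, hv⟩ := hgauss (f i)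
  have hvar : Var[f i; μ] = v := by
    rw [← variance_id_gaussianReal (μ := 0) (v := v), ← hv,
      variance_map (by fun_prop) (by fun_prop)]
    rfl
  have : v = 1 := by
    have := hcov i i
    rw [covariance_self (by fun_prop), hvar] at this
    simpa using this
  rw [hv, this]

/-- **Gaussian Poincaré inequality for cylinder functions.** Let `μ` be a Gaussian
measure on a separable Banach space `W` and let `f₁, …, fₙ ∈ W*` be orthonormal for the
covariance form `q(f,g) = ∫ f(x) g(x) dμ`. For a smooth compactly supported
`φ : ℝⁿ → ℝ` and the cylinder function `F(x) = φ(f₁(x), …, fₙ(x))`, the variance of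
`F` is bounded by the `L²(μ)`-norm squared of the Malliavin gradient of `F`:
`∫ |F - ∫ F dμ|² dμ ≤ ∫ ∑ᵢ |∂ᵢφ(f₁(x), …, fₙ(x))|² dμ`. -/
theorem gaussian_poincare_inequality_cylinder
    {W : Type*} [NormedAddCommGroup W] [NormedSpace ℝ W] [CompleteSpace W]
    [SecondCountableTopology W] [MeasurableSpace W] [BorelSpace W]
    (μ : Measure W) (hμ : IsGaussianMeasure μ)
    (n : ℕ) (f : Fin n → W →L[ℝ] ℝ)
    (horth : ∀ i j, ∫ x, f i x * f j x ∂μ = if i = j then 1 else 0)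
    (φ : (Fin n → ℝ) → ℝ) (hφ : ContDiff ℝ (⊤ : ℕ∞) φ) (hsupp : HasCompactSupport φ) :
    ∫ x, (φ (fun i => f i x) - ∫ x', φ (fun i => f i x') ∂μ) ^ 2 ∂μ ≤
      ∫ x, ∑ i, (fderiv ℝ φ (fun j => f j x) (Pi.single i 1)) ^ 2 ∂μ := by
  have hφ1 : ContDiff ℝ 1 φ := hφ.of_le (by norm_cast)
  obtain ⟨C, hC⟩ := hsupp.exists_bound_of_continuous hφ1.continuous
  obtain ⟨K, hK⟩ := (hsupp.fderiv ℝ).exists_bound_of_continuous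
    (hφ1.continuous_fderiv one_ne_zero)
  have hmap := hμ.map_eq_pi_gaussianReal horth
  have hmain := variance_pi_gaussianReal_le hφ1 hC hK
  have hφc := hφ1.continuous
  have hDc := hφ1.continuous_fderiv one_ne_zero
  have hcyl : ∀ {u : (Fin n → ℝ) → ℝ}, Continuous u →
      ∫ x, u (fun i => f i x) ∂μ = ∫ y, u y ∂(Measure.pi fun _ : Fin n => gaussianReal 0 1) :=
    fun {u} hu => by
      rw [← hmap, integral_map (Continuous.aemeasurable (by fun_prop)) hu.aestronglyMeasurable]
  rw [hcyl hφc, hcyl (u := fun y => ∑ i, (fderiv ℝ φ y (Pi.single i 1)) ^ 2) (by fun_prop),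
    hcyl (u := fun y => (φ y - ∫ y', φ y' ∂(Measure.pi fun _ : Fin n => gaussianReal 0 1)) ^ 2)
      (by fun_prop), ← variance_eq_integral hφc.aemeasurable]
  exact hmain
end

section
/- (Logarithmic Sobolev inequality for cylinder functions) Let μ be a Gaussian measure on a separable Banach space W with covariance form q(f,g) = ∫_W f(x) g(x) μ(dx), and let f_1, ..., f_n ∈ W* be q-orthonormal, i.e. q(f_i, f_j) = δ_{ij}. Let φ : ℝⁿ → ℝ be a smooth compactly supported function and define the cylinder function F(x) = φ(f_1(x), ..., f_n(x)). Then, with the convention 0² ln 0 = 0, ∫_W F(x)² ln |F(x)| μ(dx) ≤ ‖F‖²_{L²(μ)} · ln ‖F‖_{L²(μ)} + ∫_W ∑_{i=1}^n |∂_i φ(f_1(x), ..., f_n(x))|² μ(dx). -/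
open MeasureTheory ProbabilityTheory
open scoped NNReal ENNReal

section Entropy

open Real Filter Topology

/-- The entropy functional `∫ g log g dμ - (∫ g dμ) log (∫ g dμ)`. -/
noncomputable def entropy {α : Type*} [MeasurableSpace α] (μ : Measure α) (g : α → ℝ) : ℝ :=
  ∫ x, g x * log (g x) ∂μ - (∫ x, g x ∂μ) * log (∫ x, g x ∂μ)

lemma mul_log_le_mul_log_add_sub {u c : ℝ} (hu : 0 < u) (hc : 0 < c) :
    u * log c ≤ u * log u + c - u := by
  have h := mul_le_mul_of_nonneg_left (log_le_sub_one_of_pos (div_pos hc hu)) hu.le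
  rw [log_div hc.ne' hu.ne'] at h
  have : u * (c / u - 1) = c - u := by field_simp
  linarith

lemma integrable_of_measurable_of_abs_le {α : Type*} [MeasurableSpace α] {μ : Measure α}
    [IsFiniteMeasure μ] {g : α → ℝ} (hg : Measurable g) {C : ℝ} (h : ∀ x, |g x| ≤ C) :
    Integrable g μ :=
  Integrable.of_bound hg.aestronglyMeasurable C (ae_of_all _ h)

section Bounded

variable {α : Type*} [MeasurableSpace α] {μ : Measure α} [IsProbabilityMeasure μ]
  {g : α → ℝ} {ε M : ℝ}

lemma integrable_of_mem_Icc (hg : Measurable g) (h : ∀ x, g x ∈ Set.Icc ε M) :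
    Integrable g μ :=
  integrable_of_measurable_of_abs_le hg (C := max |ε| |M|)
    fun x => abs_le_max_abs_abs (h x).1 (h x).2

lemma integral_mem_Icc (hg : Measurable g) (h : ∀ x, g x ∈ Set.Icc ε M) :
    ∫ x, g x ∂μ ∈ Set.Icc ε M := by
  have hi : Integrable g μ := integrable_of_mem_Icc hg h
  constructor
  · simpa using integral_mono (integrable_const ε) hi fun x => (h x).1
  · simpa using integral_mono hi (integrable_const M) fun x => (h x).2

lemma abs_log_le_of_mem_Icc (hε : 0 < ε) {u : ℝ} (h : u ∈ Set.Icc ε M) :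
    |log u| ≤ max |log ε| |log M| :=
  abs_le_max_abs_abs (log_le_log hε h.1) (log_le_log (hε.trans_le h.1) h.2)

lemma abs_mul_log_le_of_mem_Icc (hε : 0 < ε) {u v : ℝ} (hu : u ∈ Set.Icc ε M)
    (hv : v ∈ Set.Icc ε M) : |u * log v| ≤ M * max |log ε| |log M| := by
  have h0 : 0 ≤ M := hε.le.trans (hu.1.trans hu.2)
  rw [abs_mul, abs_of_pos (hε.trans_le hu.1)]
  exact mul_le_mul hu.2 (abs_log_le_of_mem_Icc hε hv) (abs_nonneg _) h0

lemma integrable_mul_log (hε : 0 < ε) {k : α → ℝ} (hg : Measurable g) (hk : Measurable k)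
    (h : ∀ x, g x ∈ Set.Icc ε M) (h' : ∀ x, k x ∈ Set.Icc ε M) :
    Integrable (fun x => g x * log (k x)) μ :=
  integrable_of_measurable_of_abs_le (hg.mul hk.log)
    fun x => abs_mul_log_le_of_mem_Icc hε (h x) (h' x)

lemma abs_entropy_le (hε : 0 < ε) (hg : Measurable g) (h : ∀ x, g x ∈ Set.Icc ε M) :
    |entropy μ g| ≤ 2 * (M * max |log ε| |log M|) := by
  have h1 : |∫ x, g x * log (g x) ∂μ| ≤ M * max |log ε| |log M| := by
    have := norm_integral_le_of_norm_le_const (μ := μ) (f := fun x => g x * log (g x))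
      (C := M * max |log ε| |log M|)
      (ae_of_all _ fun x => abs_mul_log_le_of_mem_Icc hε (h x) (h x))
    simpa using this
  have hm := integral_mem_Icc (μ := μ) hg h
  have h2 := abs_mul_log_le_of_mem_Icc hε hm hm
  rw [entropy]
  exact (abs_sub _ _).trans (by linarith)

lemma entropy_le_integral (hε : 0 < ε) (hg : Measurable g) (h : ∀ x, g x ∈ Set.Icc ε M)
    {c : ℝ} (hc : 0 < c) :
    entropy μ g ≤ ∫ x, (g x * log (g x) - g x * log c - g x + c) ∂μ := by
  have hi : Integrable g μ := integrable_of_mem_Icc hg h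
  have hl : Integrable (fun x => g x * log (g x)) μ := integrable_mul_log hε hg hg h h
  have hm := integral_mem_Icc (μ := μ) hg h
  rw [integral_add (by fun_prop) (by fun_prop), integral_sub (by fun_prop) hi,
    integral_sub hl (by fun_prop), integral_mul_const, entropy]
  simp only [integral_const, probReal_univ, one_smul]
  have := mul_log_le_mul_log_add_sub (hε.trans_le hm.1) hc
  linarith

end Bounded

lemma measurable_integral_left {α β : Type*} [MeasurableSpace α] [MeasurableSpace β]
    {μ : Measure α} [SFinite μ] {g : α × β → ℝ} (hg : Measurable g) :
    Measurable fun y => ∫ x, g (x, y) ∂μ :=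
  (hg.stronglyMeasurable.integral_prod_left' (μ := μ)).measurable

lemma measurable_integral_right {α β : Type*} [MeasurableSpace α] [MeasurableSpace β]
    {ν : Measure β} [SFinite ν] {g : α × β → ℝ} (hg : Measurable g) :
    Measurable fun x => ∫ y, g (x, y) ∂ν :=
  (hg.stronglyMeasurable.integral_prod_right' (ν := ν)).measurable

section Prod

variable {α β : Type*} [MeasurableSpace α] [MeasurableSpace β] {μ : Measure α} {ν : Measure β}
  [IsProbabilityMeasure μ] [IsProbabilityMeasure ν] {g : α × β → ℝ} {ε M : ℝ}

lemma measurable_entropy_left (hg : Measurable g) :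
    Measurable fun y => entropy μ fun x => g (x, y) := by
  have h1 := measurable_integral_left (μ := μ) hg
  have h2 := measurable_integral_left (μ := μ) (hg.mul hg.log)
  exact h2.sub (h1.mul h1.log)

lemma measurable_entropy_right (hg : Measurable g) :
    Measurable fun x => entropy ν fun y => g (x, y) := by
  have h1 := measurable_integral_right (ν := ν) hg
  have h2 := measurable_integral_right (ν := ν) (hg.mul hg.log)
  exact h2.sub (h1.mul h1.log)

/-- Subadditivity (tensorization) of entropy for a product of two probability measures. -/
lemma entropy_prod_le (hε : 0 < ε) (hg : Measurable g) (h : ∀ p, g p ∈ Set.Icc ε M) :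
    entropy (μ.prod ν) g ≤
      ∫ y, entropy μ (fun x => g (x, y)) ∂ν + ∫ x, entropy ν (fun y => g (x, y)) ∂μ := by
  set a : β → ℝ := fun y => ∫ x, g (x, y) ∂μ with ha
  set b : α → ℝ := fun x => ∫ y, g (x, y) ∂ν with hb
  set m : ℝ := ∫ p, g p ∂μ.prod ν with hm
  have hgi : Integrable g (μ.prod ν) := integrable_of_mem_Icc hg h
  have hli : Integrable (fun p => g p * log (g p)) (μ.prod ν) := integrable_mul_log hε hg hg h h
  have ham : Measurable a := measurable_integral_left hg
  have hbm : Measurable b := measurable_integral_right hg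
  have haI : ∀ y, a y ∈ Set.Icc ε M := fun y =>
    integral_mem_Icc (hg.comp measurable_prodMk_right) fun x => h (x, y)
  have hbI : ∀ x, b x ∈ Set.Icc ε M := fun x =>
    integral_mem_Icc (hg.comp measurable_prodMk_left) fun y => h (x, y)
  have hmI : m ∈ Set.Icc ε M := integral_mem_Icc hg h
  have hm0 : 0 < m := hε.trans_le hmI.1
  have hga : Integrable (fun p : α × β => g p * log (a p.2)) (μ.prod ν) :=
    integrable_mul_log hε hg (ham.comp measurable_snd) h fun p => haI p.2
  have hgb : Integrable (fun p : α × β => g p * log (b p.1)) (μ.prod ν) :=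
    integrable_mul_log hε hg (hbm.comp measurable_fst) h fun p => hbI p.1
  have hai : Integrable a ν := integrable_of_mem_Icc ham haI
  have hbi : Integrable b μ := integrable_of_mem_Icc hbm hbI
  have hab : Integrable (fun p : α × β => b p.1 * a p.2) (μ.prod ν) := hbi.mul_prod hai
  have ea : ∫ p, g p * log (a p.2) ∂μ.prod ν = ∫ y, a y * log (a y) ∂ν := by
    rw [integral_prod_symm _ hga]
    simp only [integral_mul_const, ha]
  have eb : ∫ p, g p * log (b p.1) ∂μ.prod ν = ∫ x, b x * log (b x) ∂μ := by
    rw [integral_prod _ hgb]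
    simp only [integral_mul_const, hb]
  have ma : ∫ y, a y ∂ν = m := (integral_prod_symm _ hgi).symm
  have mb : ∫ x, b x ∂μ = m := (integral_prod _ hgi).symm
  have eab : ∫ p : α × β, b p.1 * a p.2 ∂μ.prod ν = m * m := by
    rw [integral_prod_mul, ma, mb]
  have key : ∫ p : α × β, (g p * log (a p.2) + g p * log (b p.1) - g p * log m) ∂μ.prod ν ≤
      ∫ p : α × β, (g p * log (g p) + b p.1 * a p.2 / m - g p) ∂μ.prod ν := by
    refine integral_mono (by fun_prop) (by fun_prop) fun p => ?_
    have pa := hε.trans_le (haI p.2).1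
    have pb := hε.trans_le (hbI p.1).1
    have := mul_log_le_mul_log_add_sub (hε.trans_le (h p).1) (div_pos (mul_pos pb pa) hm0)
    rw [log_div (mul_pos pb pa).ne' hm0.ne', log_mul pb.ne' pa.ne'] at this
    dsimp only
    linarith
  rw [integral_sub (by fun_prop) (by fun_prop), integral_add hga hgb,
    integral_sub (by fun_prop) hgi, integral_add hli (by fun_prop), integral_mul_const,
    integral_div, eab, ea, eb, mul_div_cancel_right₀ _ hm0.ne'] at key
  have e1 : ∫ y, entropy μ (fun x => g (x, y)) ∂ν =
      ∫ p, g p * log (g p) ∂μ.prod ν - ∫ y, a y * log (a y) ∂ν := by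
    rw [integral_prod_symm _ hli]
    exact integral_sub hli.integral_prod_right (integrable_mul_log hε ham ham haI haI)
  have e2 : ∫ x, entropy ν (fun y => g (x, y)) ∂μ =
      ∫ p, g p * log (g p) ∂μ.prod ν - ∫ x, b x * log (b x) ∂μ := by
    rw [integral_prod _ hli]
    exact integral_sub hli.integral_prod_left (integrable_mul_log hε hbm hbm hbI hbI)
  rw [e1, e2, entropy]
  linarith

end Prod

lemma log_one_add_le_cubic {z : ℝ} (hz : -1 < z) :
    log (1 + z) ≤ z - z ^ 2 / 2 + z ^ 3 / 3 := by
  set F : ℝ → ℝ := fun z => z - z ^ 2 / 2 + z ^ 3 / 3 - log (1 + z) with hF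
  have hd : ∀ w : ℝ, -1 < w → HasDerivAt F (w ^ 3 / (1 + w)) w := fun w hw => by
    have hw' : 1 + w ≠ 0 := by linarith
    have h1 : HasDerivAt (fun z : ℝ => log (1 + z)) (1 / (1 + w)) w :=
      ((hasDerivAt_id w).const_add 1).log hw'
    convert! (((hasDerivAt_id w).sub ((hasDerivAt_pow 2 w).div_const 2)).add
      ((hasDerivAt_pow 3 w).div_const 3)).sub h1 using 1
    field_simp
    ring
  have hF0 : F 0 = 0 := by simp [hF]
  suffices F 0 ≤ F z by
    rw [hF0] at this
    simp only [hF] at this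
    linarith
  have hc : ∀ s : Set ℝ, s ⊆ Set.Ioi (-1) → ContinuousOn F s := fun s hs w hw =>
    (hd w (hs hw)).continuousAt.continuousWithinAt
  rcases le_total 0 z with h | h
  · refine monotoneOn_of_deriv_nonneg (convex_Ici 0)
      (hc _ fun w hw => show -1 < w by linarith [Set.mem_Ici.1 hw]) ?_ ?_ Set.self_mem_Ici h h
    · rw [interior_Ici]
      exact fun w hw => (hd w (lt_trans (by norm_num) hw)).differentiableAt.differentiableWithinAt
    · rw [interior_Ici]
      intro w (hw : 0 < w)
      rw [(hd w (by linarith)).deriv]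
      positivity
  · refine antitoneOn_of_deriv_nonpos (convex_Ioc (-1) 0)
      (hc _ fun w hw => hw.1) ?_ ?_ ⟨hz, h⟩ ⟨by norm_num, le_rfl⟩ h
    · rw [interior_Ioc]
      exact fun w hw => (hd w hw.1).differentiableAt.differentiableWithinAt
    · rw [interior_Ioc]
      intro w hw
      rw [(hd w hw.1).deriv]
      exact div_nonpos_of_nonpos_of_nonneg (Odd.pow_nonpos (by decide) hw.2.le)
        (by linarith [hw.1])

lemma mul_log_bregman_le {ε M u c : ℝ} (hε : 0 < ε) (hu : u ∈ Set.Icc ε M)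
    (hc : c ∈ Set.Icc ε M) :
    u * log u - u * log c - u + c ≤
      (u - c) ^ 2 / (2 * c) + (1 / 6 + M / ε / 3) / ε ^ 2 * |u - c| ^ 3 := by
  have hu0 := hε.trans_le hu.1
  have hc0 := hε.trans_le hc.1
  set z := (u - c) / c with hz
  have huz : u = c * (1 + z) := by rw [hz]; field_simp; ring
  have hz1 : -1 < z := by rw [hz, lt_div_iff₀ hc0]; linarith
  have hlog : log u = log c + log (1 + z) := by
    rw [huz, log_mul hc0.ne' (by linarith)]
  have hzM : |z| ≤ M / ε := by
    rw [hz, abs_div, abs_of_pos hc0]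
    have : |u - c| ≤ M := abs_le.2 ⟨by linarith [hc.2], by linarith [hu.2]⟩
    exact div_le_div₀ (hε.le.trans (hu.1.trans hu.2)) this hε hc.1
  have h1 : u * log u - u * log c - u + c ≤ c * (z ^ 2 / 2 - z ^ 3 / 6 + z ^ 4 / 3) := by
    have := mul_le_mul_of_nonneg_left (log_one_add_le_cubic hz1) hu0.le
    calc u * log u - u * log c - u + c = u * log (1 + z) - u + c := by rw [hlog]; ring
      _ ≤ u * (z - z ^ 2 / 2 + z ^ 3 / 3) - u + c := by linarith
      _ = _ := by rw [huz]; ring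
  have h2 : z ^ 2 / 2 - z ^ 3 / 6 + z ^ 4 / 3 ≤ z ^ 2 / 2 + (1 / 6 + M / ε / 3) * |z| ^ 3 := by
    have e4 : z ^ 4 = |z| * |z| ^ 3 := by rw [← pow_succ', Even.pow_abs (by decide)]
    have e3 : -z ^ 3 ≤ |z| ^ 3 := by rw [← abs_pow]; exact neg_le_abs _
    have : |z| * |z| ^ 3 ≤ M / ε * |z| ^ 3 := by gcongr
    rw [e4]
    linarith
  have h3 : c * (z ^ 2 / 2) = (u - c) ^ 2 / (2 * c) := by rw [hz]; field_simp
  have h4 : c * |z| ^ 3 ≤ |u - c| ^ 3 / ε ^ 2 := by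
    have : c * |z| ^ 3 = |u - c| ^ 3 / c ^ 2 := by
      rw [hz, abs_div, abs_of_pos hc0]; field_simp
    rw [this]
    have := hc.1
    gcongr
  have hC : 0 ≤ 1 / 6 + M / ε / 3 := by
    have : 0 ≤ M / ε := (abs_nonneg z).trans hzM
    positivity
  calc _ ≤ c * (z ^ 2 / 2 - z ^ 3 / 6 + z ^ 4 / 3) := h1
    _ ≤ c * (z ^ 2 / 2 + (1 / 6 + M / ε / 3) * |z| ^ 3) := by gcongr
    _ = c * (z ^ 2 / 2) + (1 / 6 + M / ε / 3) * (c * |z| ^ 3) := by ring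
    _ ≤ (u - c) ^ 2 / (2 * c) + (1 / 6 + M / ε / 3) * (|u - c| ^ 3 / ε ^ 2) := by
      rw [h3]; gcongr
    _ = _ := by ring

lemma abs_sub_sub_deriv_mul_le {g : ℝ → ℝ} (hg : Differentiable ℝ g) {K : ℝ≥0}
    (hK : LipschitzWith K (deriv g)) (x y : ℝ) :
    |g (x + y) - g x - deriv g x * y| ≤ K * y ^ 2 := by
  have h := Convex.norm_image_sub_le_of_norm_hasDerivWithin_le
    (f := fun t => g t - deriv g x * t) (f' := fun t => deriv g t - deriv g x)
    (s := Set.uIcc x (x + y)) (C := K * |y|) (x := x) (y := x + y)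
    (fun t _ => ((hg t).hasDerivAt.sub
      (((hasDerivAt_id t).const_mul (deriv g x)).congr_deriv (mul_one _))).hasDerivWithinAt)
    (fun t ht => by
      refine (hK.norm_sub_le t x).trans ?_
      gcongr
      simpa using Set.abs_sub_left_of_mem_uIcc ht)
    (convex_uIcc _ _) Set.left_mem_uIcc Set.right_mem_uIcc
  have e : g (x + y) - deriv g x * (x + y) - (g x - deriv g x * x) =
      g (x + y) - g x - deriv g x * y := by ring
  rw [e, add_sub_cancel_left, Real.norm_eq_abs, Real.norm_eq_abs, mul_assoc, abs_mul_abs_self]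
    at h
  rwa [sq]

lemma exists_bregman_le_deriv_sq {g : ℝ → ℝ} {ε M : ℝ} (hε : 0 < ε)
    (h : ∀ x, g x ∈ Set.Icc ε M) (hg : Differentiable ℝ g) {L K : ℝ≥0}
    (hL : LipschitzWith L g) (hK : LipschitzWith K (deriv g)) :
    ∃ C : ℝ, ∀ x y, g (x + y) * log (g (x + y)) - g (x + y) * log (g x) - g (x + y) + g x ≤
      deriv g x ^ 2 / (2 * g x) * y ^ 2 + C * |y| ^ 3 := by
  refine ⟨K * L / ε + (1 / 6 + M / ε / 3) / ε ^ 2 * L ^ 3, fun x y => ?_⟩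
  have hx := hε.trans_le (h x).1
  have hM : 0 ≤ M := hx.le.trans (h x).2
  have hb := mul_log_bregman_le hε (h (x + y)) (h x)
  have hLy : |g (x + y) - g x| ≤ L * |y| := by simpa using hL.norm_sub_le (x + y) x
  have hdL : |deriv g x| ≤ L := norm_deriv_le_of_lipschitz hL
  have hKy := abs_sub_sub_deriv_mul_le hg hK x y
  have hdy : |deriv g x * y| ≤ L * |y| := by rw [abs_mul]; gcongr
  have hsq : (g (x + y) - g x) ^ 2 ≤ (deriv g x * y) ^ 2 + K * y ^ 2 * (2 * L * |y|) := by
    have e : (g (x + y) - g x) ^ 2 - (deriv g x * y) ^ 2 =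
        (g (x + y) - g x - deriv g x * y) * ((g (x + y) - g x) + deriv g x * y) := by ring
    have : |(g (x + y) - g x - deriv g x * y) * ((g (x + y) - g x) + deriv g x * y)| ≤
        K * y ^ 2 * (2 * L * |y|) := by
      rw [abs_mul]
      refine mul_le_mul hKy ?_ (abs_nonneg _) (by positivity)
      exact (abs_add_le _ _).trans (by linarith)
    linarith [le_abs_self ((g (x + y) - g x - deriv g x * y) *
      ((g (x + y) - g x) + deriv g x * y))]
  have hy3 : |y| ^ 3 = y ^ 2 * |y| := by rw [pow_succ, sq_abs]
  calc _ ≤ _ := hb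
    _ ≤ ((deriv g x * y) ^ 2 + K * y ^ 2 * (2 * L * |y|)) / (2 * g x) +
        (1 / 6 + M / ε / 3) / ε ^ 2 * (L * |y|) ^ 3 := by gcongr
    _ = deriv g x ^ 2 / (2 * g x) * y ^ 2 + K * L * |y| ^ 3 / g x +
        (1 / 6 + M / ε / 3) / ε ^ 2 * (L * |y|) ^ 3 := by
      rw [hy3]; field_simp
    _ ≤ deriv g x ^ 2 / (2 * g x) * y ^ 2 + K * L * |y| ^ 3 / ε +
        (1 / 6 + M / ε / 3) / ε ^ 2 * (L * |y|) ^ 3 := by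
      have := (h x).1
      gcongr
    _ = _ := by ring

lemma entropy_map {α β : Type*} [MeasurableSpace α] [MeasurableSpace β] {μ : Measure α}
    {T : α → β} (hT : AEMeasurable T μ) {g : β → ℝ} (hg : Measurable g) :
    entropy (μ.map T) g = entropy μ fun x => g (T x) := by
  rw [entropy, entropy, integral_map (f := fun y => g y * log (g y)) hT
    (hg.mul hg.log).aestronglyMeasurable, integral_map hT hg.aestronglyMeasurable]

lemma entropy_gaussianReal_nsmul_le {s : ℝ≥0} {g D : ℝ → ℝ} {ε M B : ℝ} (hε : 0 < ε)
    (hg : Measurable g) (h : ∀ x, g x ∈ Set.Icc ε M) (hD : Measurable D) (hB : ∀ x, |D x| ≤ B)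
    (hstep : ∀ x, entropy (gaussianReal 0 s) (fun y => g (x + y)) ≤ D x) (m : ℕ) (x : ℝ) :
    entropy (gaussianReal 0 ((m + 1) * s)) (fun y => g (x + y)) ≤
      (m + 1) * ∫ y, D (x + y) ∂gaussianReal 0 (m * s) := by
  induction m generalizing x with
  | zero => simpa using hstep x
  | succ m ih =>
    have hDi : ∀ (μ : Measure ℝ) [IsProbabilityMeasure μ] (x : ℝ),
        Integrable (fun y => D (x + y)) μ := fun μ _ x =>
      integrable_of_measurable_of_abs_le (by fun_prop) fun y => hB (x + y)
    have hDm : ∀ (μ : Measure ℝ) [IsProbabilityMeasure μ],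
        Measurable fun x => ∫ y, D (x + y) ∂μ := fun μ _ =>
      measurable_integral_right (g := fun p : ℝ × ℝ => D (p.1 + p.2)) (by fun_prop)
    have e1 : gaussianReal 0 (((m + 1 : ℕ) + 1) * s) =
        gaussianReal 0 s ∗ gaussianReal 0 ((m + 1) * s) := by
      rw [gaussianReal_conv_gaussianReal]
      push_cast
      ring_nf
    have e2 : gaussianReal 0 ((m + 1 : ℕ) * s) = gaussianReal 0 s ∗ gaussianReal 0 (m * s) := by
      rw [gaussianReal_conv_gaussianReal]
      push_cast
      ring_nf
    have hgx : Measurable fun p : ℝ × ℝ => g (x + (p.1 + p.2)) := by fun_prop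
    rw [e1, Measure.conv, entropy_map (by fun_prop) (by fun_prop)]
    refine (entropy_prod_le hε hgx fun p => h _).trans ?_
    have i1 : ∫ w, entropy (gaussianReal 0 s) (fun u => g (x + (u + w)))
        ∂gaussianReal 0 ((m + 1) * s) ≤ ∫ w, D (x + w) ∂gaussianReal 0 ((m + 1) * s) := by
      refine integral_mono (integrable_of_measurable_of_abs_le
        (measurable_entropy_left hgx) fun w => abs_entropy_le hε (by fun_prop) fun u => h _)
        (hDi _ x) fun w => ?_
      have := hstep (x + w)
      simpa only [add_assoc, add_comm w] using this
    have i2 : ∫ u, entropy (gaussianReal 0 ((m + 1) * s)) (fun w => g (x + (u + w)))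
        ∂gaussianReal 0 s ≤ (m + 1) * ∫ w, D (x + w) ∂gaussianReal 0 ((m + 1) * s) := by
      have e3 : ∫ w, D (x + w) ∂gaussianReal 0 ((m + 1 : ℕ) * s) =
          ∫ u, ∫ w, D (x + (u + w)) ∂gaussianReal 0 (m * s) ∂gaussianReal 0 s := by
        rw [e2, integral_conv (hDi _ x)]
      rw [← Nat.cast_succ, ← Nat.cast_succ, e3, ← integral_const_mul]
      refine integral_mono (integrable_of_measurable_of_abs_le
        (measurable_entropy_right hgx) fun u => abs_entropy_le hε (by fun_prop) fun w => h _)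
        ?_ fun u => ?_
      · refine (integrable_of_measurable_of_abs_le (C := B) ?_ fun u => ?_).const_mul _
        · simpa only [add_assoc, Function.comp_def] using
            (hDm (gaussianReal 0 (m * s))).comp (measurable_const_add x)
        · have := norm_integral_le_of_norm_le_const (μ := gaussianReal 0 (m * s))
            (f := fun w => D (x + (u + w))) (C := B) (ae_of_all _ fun w => hB _)
          simpa using this
      · have := ih (x + u)
        simpa only [add_assoc, Nat.cast_succ] using this
    push_cast at i1 i2 ⊢
    linarith

lemma gaussianReal_zero_eq_map (v : ℝ≥0) :
    gaussianReal 0 v = (gaussianReal 0 1).map (fun y => √(v : ℝ) * y) := by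
  rw [gaussianReal_map_const_mul]
  congr 1
  · simp
  · ext
    simp

lemma integral_abs_pow_three_gaussianReal (r : ℝ≥0) :
    ∫ y, |y| ^ 3 ∂gaussianReal 0 (r ^ 2) = r ^ 3 * ∫ y, |y| ^ 3 ∂gaussianReal 0 1 := by
  rw [gaussianReal_zero_eq_map, integral_map (by fun_prop) (by fun_prop), ← integral_const_mul]
  simp [abs_mul, mul_pow]

lemma integral_sq_gaussianReal (v : ℝ≥0) : ∫ y, y ^ 2 ∂gaussianReal 0 v = v := by
  have := variance_fun_id_gaussianReal (μ := 0) (v := v)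
  rwa [variance_of_integral_eq_zero (by fun_prop) (by simp)] at this

lemma integrable_abs_pow_gaussianReal (v : ℝ≥0) (k : ℕ) :
    Integrable (fun y => |y| ^ k) (gaussianReal 0 v) := by
  simpa using (memLp_id_gaussianReal (μ := 0) (v := v) k).integrable_norm_pow'

lemma tendsto_integral_gaussianReal {D : ℝ → ℝ} (hD : Continuous D) {B : ℝ}
    (hB : ∀ x, |D x| ≤ B) {v : ℕ → ℝ≥0} {v₀ : ℝ≥0} (hv : Tendsto v atTop (𝓝 v₀)) :
    Tendsto (fun k => ∫ y, D y ∂gaussianReal 0 (v k)) atTop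
      (𝓝 (∫ y, D y ∂gaussianReal 0 v₀)) := by
  have e : ∀ w : ℝ≥0, ∫ y, D y ∂gaussianReal 0 w =
      ∫ y, D (√(w : ℝ) * y) ∂gaussianReal 0 1 := fun w => by
    rw [gaussianReal_zero_eq_map w, integral_map (by fun_prop) (by fun_prop)]
  simp only [e]
  refine tendsto_integral_of_dominated_convergence (fun _ => B) (fun k => by fun_prop)
    (integrable_const B) (fun k => ae_of_all _ fun y => hB _) (ae_of_all _ fun y => ?_)
  have hc : Continuous fun w : ℝ≥0 => D (√(w : ℝ) * y) := by fun_prop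
  exact (hc.tendsto v₀).comp hv

/-- The one-dimensional Gaussian logarithmic Sobolev inequality for `g = φ ^ 2 + ε`. -/
lemma entropy_gaussianReal_sq_add_le {φ : ℝ → ℝ} (hφ : ContDiff ℝ (⊤ : ℕ∞) φ)
    (hsupp : HasCompactSupport φ) {ε : ℝ} (hε : 0 < ε) :
    entropy (gaussianReal 0 1) (fun x => φ x ^ 2 + ε) ≤
      ∫ x, 2 * deriv φ x ^ 2 ∂gaussianReal 0 1 := by
  set g : ℝ → ℝ := fun x => φ x ^ 2 + ε with hg
  have hψ : ContDiff ℝ (⊤ : ℕ∞) fun x => φ x ^ 2 := hφ.pow 2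
  have hψs : HasCompactSupport fun x => φ x ^ 2 := hsupp.comp_left (g := fun t => t ^ 2) (by simp)
  have hdg : deriv g = deriv fun x => φ x ^ 2 := by ext x; simp [hg]
  have hφd : Differentiable ℝ φ := hφ.differentiable (by simp)
  have hgd : Differentiable ℝ g := (hφd.pow 2).add_const ε
  have hdgx : ∀ x, deriv g x = 2 * φ x * deriv φ x := fun x => by
    rw [hdg]
    simpa using ((hφd x).hasDerivAt.fun_pow 2).deriv
  obtain ⟨M, hM⟩ := hψs.exists_bound_of_continuous hψ.continuous
  have hgI : ∀ x, g x ∈ Set.Icc ε (M + ε) := fun x =>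
    ⟨by simp only [hg]; linarith [sq_nonneg (φ x)],
      by simp only [hg]; linarith [(le_abs_self _).trans (hM x)]⟩
  obtain ⟨L, hL⟩ := hψ.lipschitzWith_of_hasCompactSupport hψs (by simp)
  have hgL : LipschitzWith L g := LipschitzWith.of_dist_le_mul fun x y => by
    simpa [hg] using hL.dist_le_mul x y
  obtain ⟨K, hK⟩ := (ContDiff.iterate_deriv' 1 1
    (contDiff_infty.1 hψ 2)).lipschitzWith_of_hasCompactSupport hψs.deriv (by simp)
  obtain ⟨C, hC⟩ := exists_bregman_le_deriv_sq hε hgI hgd hgL (K := K) (by rw [hdg]; exact hK)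
  have hdc : Continuous (deriv φ) := hφ.continuous_deriv (by simp)
  set D₀ : ℝ → ℝ := fun x => 2 * deriv φ x ^ 2 with hD₀
  have hD₀c : Continuous D₀ := by fun_prop
  obtain ⟨B, hB⟩ : ∃ B, ∀ x, ‖D₀ x‖ ≤ B := by
    refine HasCompactSupport.exists_bound_of_continuous ?_ hD₀c
    exact hsupp.deriv.comp_left (g := fun t => 2 * t ^ 2) (by simp)
  have hD₀g : ∀ x, deriv g x ^ 2 / (2 * g x) ≤ D₀ x := fun x => by
    have hgx := hε.trans_le (hgI x).1
    rw [div_le_iff₀ (by positivity), hdgx]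
    simp only [hD₀, hg]
    nlinarith [mul_nonneg hε.le (sq_nonneg (deriv φ x))]
  set m₃ := ∫ y, |y| ^ 3 ∂gaussianReal 0 1 with hm₃
  have hgm : Measurable g := hgd.continuous.measurable
  have hstep : ∀ (r : ℝ≥0) (x : ℝ), entropy (gaussianReal 0 (r ^ 2)) (fun y => g (x + y)) ≤
      D₀ x * r ^ 2 + C * (r ^ 3 * m₃) := fun r x => by
    have hgx := hε.trans_le (hgI x).1
    have i2 : Integrable (fun y : ℝ => y ^ 2) (gaussianReal 0 (r ^ 2)) := by
      simpa using integrable_abs_pow_gaussianReal (r ^ 2) 2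
    have i3 := integrable_abs_pow_gaussianReal (r ^ 2) 3
    have hgxm : Measurable fun y => g (x + y) := by fun_prop
    have j1 : Integrable (fun y => g (x + y)) (gaussianReal 0 (r ^ 2)) :=
      integrable_of_mem_Icc hgxm fun y => hgI _
    have j2 : Integrable (fun y => g (x + y) * log (g (x + y))) (gaussianReal 0 (r ^ 2)) :=
      integrable_mul_log hε hgxm hgxm (fun y => hgI _) fun y => hgI _
    calc _ ≤ ∫ y, (g (x + y) * log (g (x + y)) - g (x + y) * log (g x) - g (x + y) + g x)
          ∂gaussianReal 0 (r ^ 2) := entropy_le_integral hε hgxm (fun y => hgI _) hgx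
      _ ≤ ∫ y, (D₀ x * y ^ 2 + C * |y| ^ 3) ∂gaussianReal 0 (r ^ 2) := by
        refine integral_mono (((j2.sub (j1.mul_const _)).sub j1).add (integrable_const _))
          (by fun_prop) fun y => (hC x y).trans ?_
        gcongr
        exact hD₀g x
      _ = _ := by
        rw [integral_add (by fun_prop) (by fun_prop), integral_const_mul, integral_const_mul,
          integral_abs_pow_three_gaussianReal, integral_sq_gaussianReal]
        push_cast
        rfl
  set r : ℕ → ℝ≥0 := fun k => 1 / ((k : ℝ≥0) + 1) with hr
  set v : ℕ → ℝ≥0 := fun k => ((k ^ 2 + 2 * k : ℕ) : ℝ≥0) * r k ^ 2 with hv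
  have hbound : ∀ k : ℕ, entropy (gaussianReal 0 1) g ≤
      ∫ y, D₀ y ∂gaussianReal 0 (v k) + C * m₃ * r k := fun k => by
    have hD₀i : Integrable D₀ (gaussianReal 0 (v k)) :=
      integrable_of_measurable_of_abs_le hD₀c.measurable hB
    have := entropy_gaussianReal_nsmul_le (s := r k ^ 2)
      (D := fun x => D₀ x * r k ^ 2 + C * (r k ^ 3 * m₃))
      (B := B * r k ^ 2 + |C * (r k ^ 3 * m₃)|) hε hgm hgI (by fun_prop)
      (fun x => (abs_add_le _ _).trans (by
        rw [abs_mul, abs_of_nonneg (a := (r k : ℝ) ^ 2) (by positivity)]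
        gcongr
        exact hB x)) (hstep (r k)) (k ^ 2 + 2 * k) 0
    simp only [zero_add] at this
    have hk : ((k ^ 2 + 2 * k : ℕ) + 1 : ℝ≥0) * r k ^ 2 = 1 := by
      have : (k : ℝ≥0) + 1 ≠ 0 := by positivity
      simp only [hr]
      push_cast
      field_simp
      ring
    have hk' : ((k ^ 2 + 2 * k : ℕ) + 1 : ℝ) * r k ^ 2 = 1 := by exact_mod_cast hk
    rw [hk, integral_add (by fun_prop) (by fun_prop), integral_mul_const] at this
    refine this.trans_eq ?_
    simp only [integral_const, probReal_univ, one_smul]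
    calc _ = (((k ^ 2 + 2 * k : ℕ) + 1 : ℝ) * r k ^ 2) *
          (∫ y, D₀ y ∂gaussianReal 0 (v k) + C * m₃ * r k) := by ring
      _ = _ := by rw [hk', one_mul]
  have hr0 : Tendsto (fun k => (r k : ℝ)) atTop (𝓝 0) := by
    simpa [hr] using tendsto_one_div_add_atTop_nhds_zero_nat (𝕜 := ℝ)
  have hv1 : Tendsto v atTop (𝓝 1) := by
    rw [← NNReal.tendsto_coe]
    have e : ∀ k, (v k : ℝ) = 1 - r k ^ 2 := fun k => by
      have : (k : ℝ) + 1 ≠ 0 := by positivity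
      simp only [hv, hr]
      push_cast
      field_simp
      ring
    simp only [e]
    simpa using (hr0.pow 2).const_sub 1
  refine ge_of_tendsto' (x := atTop) ?_ hbound
  simpa using (tendsto_integral_gaussianReal hD₀c hB hv1).add (hr0.const_mul (C * m₃))

lemma map_cons_prod_pi (n : ℕ) (μ : Measure ℝ) [SigmaFinite μ] :
    (μ.prod (Measure.pi fun _ : Fin n => μ)).map
      (fun p => (Fin.cons p.1 p.2 : Fin (n + 1) → ℝ)) = Measure.pi fun _ => μ := by
  convert! (measurePreserving_piFinSuccAbove (fun _ : Fin (n + 1) => μ) 0).symm.map_eq using 2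
  ext p i
  simp [MeasurableEquiv.piFinSuccAbove_symm_apply]

lemma continuous_fin_cons (n : ℕ) :
    Continuous fun p : ℝ × (Fin n → ℝ) => (Fin.cons p.1 p.2 : Fin (n + 1) → ℝ) :=
  Continuous.finCons (A := fun _ => ℝ) continuous_fst continuous_snd

/-- The Gaussian logarithmic Sobolev inequality on `ℝⁿ` for `φ ^ 2 + ε`. -/
lemma entropy_pi_gaussianReal_sq_add_le {n : ℕ} {φ : (Fin n → ℝ) → ℝ}
    (hφ : ContDiff ℝ (⊤ : ℕ∞) φ) (hsupp : HasCompactSupport φ) {ε : ℝ} (hε : 0 < ε) :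
    entropy (Measure.pi fun _ : Fin n => gaussianReal 0 1) (fun x => φ x ^ 2 + ε) ≤
      ∫ x, ∑ i, 2 * fderiv ℝ φ x (Pi.single i 1) ^ 2
        ∂Measure.pi fun _ : Fin n => gaussianReal 0 1 := by
  induction n with
  | zero =>
    obtain ⟨c, rfl⟩ : ∃ c, φ = fun _ => c :=
      ⟨φ 0, funext fun x => congrArg φ (Subsingleton.elim _ _)⟩
    simp [entropy]
  | succ n ih =>
    set γ := gaussianReal 0 1
    set γn := Measure.pi fun _ : Fin n => γ
    set T : ℝ × (Fin n → ℝ) → (Fin (n + 1) → ℝ) := fun p => Fin.cons p.1 p.2 with hT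
    have hTc : Continuous T := continuous_fin_cons n
    have hTm : Measurable T := hTc.measurable
    have hφc : Continuous φ := hφ.continuous
    have hφd : Differentiable ℝ φ := hφ.differentiable (by simp)
    have hdc : ∀ v, Continuous fun x => fderiv ℝ φ x v := fun v =>
      (hφ.continuous_fderiv (by simp)).clm_apply continuous_const
    have hdi : ∀ v, Integrable (fun p => 2 * fderiv ℝ φ (T p) v ^ 2) (γ.prod γn) := by
      intro v
      obtain ⟨B, hB⟩ := HasCompactSupport.exists_bound_of_continuous
        (f := fun x => 2 * fderiv ℝ φ x v ^ 2)
        ((hsupp.fderiv_apply (𝕜 := ℝ) v).comp_left (g := fun t => 2 * t ^ 2) (by simp))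
        (((hdc v).pow 2).const_mul 2)
      exact integrable_of_measurable_of_abs_le
        ((((hdc v).pow 2).const_mul 2).comp hTc).measurable fun p => hB (T p)
    obtain ⟨M, hM⟩ := HasCompactSupport.exists_bound_of_continuous (f := fun x => φ x ^ 2)
      (hsupp.comp_left (g := fun t => t ^ 2) (by simp)) (hφc.pow 2)
    have hgI : ∀ p, φ (T p) ^ 2 + ε ∈ Set.Icc ε (M + ε) := fun p =>
      ⟨by linarith [sq_nonneg (φ (T p))], by linarith [(le_abs_self _).trans (hM (T p))]⟩
    have hgm : Measurable fun p => φ (T p) ^ 2 + ε :=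
      (((hφc.comp hTc).pow 2).add_const ε).measurable
    have h1 : ∀ y, entropy γ (fun x => φ (T (x, y)) ^ 2 + ε) ≤
        ∫ x, 2 * fderiv ℝ φ (T (x, y)) (Pi.single 0 1) ^ 2 ∂γ := fun y => by
      have hd : ∀ x, HasDerivAt (fun t => T (t, y)) (Pi.single 0 1) x := fun x => by
        refine hasDerivAt_pi.2 fun i => ?_
        refine Fin.cases ?_ (fun j => ?_) i
        · simpa [hT] using hasDerivAt_id' x
        · simpa [hT] using hasDerivAt_const x (y j)
      have hc : IsClosedEmbedding fun t => T (t, y) :=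
        Function.LeftInverse.isClosedEmbedding (f := fun z => z 0) (fun t => by simp [hT])
          (by fun_prop) (by fun_prop)
      have hs : ContDiff ℝ (⊤ : ℕ∞) fun t => φ (T (t, y)) := by
        refine hφ.comp (contDiff_pi.2 fun i => ?_)
        refine Fin.cases ?_ (fun j => ?_) i
        · simpa [hT] using contDiff_fun_id
        · simpa [hT] using contDiff_const
      have := entropy_gaussianReal_sq_add_le hs (hsupp.comp_isClosedEmbedding hc) hε
      convert! this using 5 with x
      exact ((hφd _).hasFDerivAt.comp_hasDerivAt x (hd x)).deriv.symm
    have h2 : ∀ x, entropy γn (fun y => φ (T (x, y)) ^ 2 + ε) ≤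
        ∫ y, ∑ i : Fin n, 2 * fderiv ℝ φ (T (x, y)) (Pi.single i.succ 1) ^ 2 ∂γn := fun x => by
      have hc : IsClosedEmbedding fun y => T (x, y) :=
        Function.LeftInverse.isClosedEmbedding (f := fun (z : Fin (n + 1) → ℝ) i => z (Fin.succ i))
          (fun t => by simp [hT])
          (continuous_pi fun i => continuous_apply i.succ) (by fun_prop)
      have hs : ContDiff ℝ (⊤ : ℕ∞) fun y => φ (T (x, y)) := by
        refine hφ.comp (contDiff_pi.2 fun i => ?_)
        refine Fin.cases ?_ (fun j => ?_) i
        · simpa [hT] using contDiff_const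
        · simpa [hT] using contDiff_apply ℝ ℝ j
      have := ih hs (hsupp.comp_isClosedEmbedding hc)
      convert! this using 5 with y i
      have e : ∀ t : ℝ, T (x, y + t • Pi.single i 1) = T (x, y) + t • Pi.single i.succ 1 :=
        fun t => by
          ext j
          refine Fin.cases ?_ (fun j => ?_) j
          · simp [hT]
          · simp [hT, Pi.single_apply]
      rw [← (hφd _).lineDeriv_eq_fderiv, ← (hs.differentiable (by simp) _).lineDeriv_eq_fderiv]
      simp only [lineDeriv, e]
    rw [← map_cons_prod_pi n γ, entropy_map hTm.aemeasurable (by fun_prop),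
      integral_map hTm.aemeasurable (Continuous.aestronglyMeasurable <|
        continuous_finsetSum _ fun i _ => by have := hdc (Pi.single i 1); fun_prop)]
    refine (entropy_prod_le hε hgm hgI).trans ?_
    simp only [Fin.sum_univ_succ]
    have hF1 : Integrable (fun p => ∑ i : Fin n, 2 * fderiv ℝ φ (T p) (Pi.single i.succ 1) ^ 2)
        (γ.prod γn) := integrable_finsetSum _ fun i _ => hdi _
    rw [integral_add (hdi _) hF1, integral_prod_symm _ (hdi _), integral_prod _ hF1]
    refine add_le_add (integral_mono ?_ (hdi _).integral_prod_right h1)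
      (integral_mono ?_ hF1.integral_prod_left h2)
    · exact integrable_of_measurable_of_abs_le (measurable_entropy_left hgm) fun y =>
        abs_entropy_le hε (hgm.comp measurable_prodMk_right) fun x => hgI _
    · exact integrable_of_measurable_of_abs_le (measurable_entropy_right hgm) fun x =>
        abs_entropy_le hε (hgm.comp measurable_prodMk_left) fun y => hgI _

/-- The Gaussian logarithmic Sobolev inequality on `ℝⁿ`, in entropy form. -/
lemma entropy_pi_gaussianReal_sq_le {n : ℕ} {φ : (Fin n → ℝ) → ℝ}
    (hφ : ContDiff ℝ (⊤ : ℕ∞) φ) (hsupp : HasCompactSupport φ) :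
    entropy (Measure.pi fun _ : Fin n => gaussianReal 0 1) (fun x => φ x ^ 2) ≤
      ∫ x, ∑ i, 2 * fderiv ℝ φ x (Pi.single i 1) ^ 2
        ∂Measure.pi fun _ : Fin n => gaussianReal 0 1 := by
  set γ := Measure.pi fun _ : Fin n => gaussianReal 0 1
  have hφc : Continuous φ := hφ.continuous
  obtain ⟨M, hM⟩ := HasCompactSupport.exists_bound_of_continuous (f := fun x => φ x ^ 2)
    (hsupp.comp_left (g := fun t => t ^ 2) (by simp)) (hφc.pow 2)
  have hM' : ∀ x, φ x ^ 2 ≤ M := fun x => (le_abs_self _).trans (hM x)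
  obtain ⟨B, hB⟩ := (isCompact_Icc (a := (0 : ℝ)) (b := M + 1)).exists_bound_of_continuousOn
    continuous_mul_log.continuousOn
  set e : ℕ → ℝ := fun k => 1 / ((k : ℝ) + 1)
  have he : Tendsto e atTop (𝓝 0) := tendsto_one_div_add_atTop_nhds_zero_nat
  have he0 : ∀ k, 0 < e k := fun k => Nat.one_div_pos_of_nat
  have he1 : ∀ k, e k ≤ 1 := fun k => by
    simpa [e] using Nat.one_div_le_one_div (α := ℝ) (Nat.zero_le k)
  have hI : ∀ k x, φ x ^ 2 + e k ∈ Set.Icc 0 (M + 1) := fun k x =>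
    ⟨by have := he0 k; positivity, add_le_add (hM' x) (he1 k)⟩
  have hpt : ∀ x, Tendsto (fun k => φ x ^ 2 + e k) atTop (𝓝 (φ x ^ 2)) := fun x => by
    simpa using he.const_add (φ x ^ 2)
  have t1 : Tendsto (fun k => ∫ x, (φ x ^ 2 + e k) * log (φ x ^ 2 + e k) ∂γ) atTop
      (𝓝 (∫ x, φ x ^ 2 * log (φ x ^ 2) ∂γ)) := by
    refine tendsto_integral_of_dominated_convergence (fun _ => B) (fun k => ?_)
      (integrable_const B) (fun k => ae_of_all _ fun x => hB _ (hI k x))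
      (ae_of_all _ fun x => (continuous_mul_log.tendsto _).comp (hpt x))
    exact (continuous_mul_log.comp ((hφc.pow 2).add_const (e k))).aestronglyMeasurable
  have t2 : Tendsto (fun k => ∫ x, (φ x ^ 2 + e k) ∂γ) atTop (𝓝 (∫ x, φ x ^ 2 ∂γ)) := by
    refine tendsto_integral_of_dominated_convergence (fun _ => M + 1) (fun k => by fun_prop)
      (integrable_const _) (fun k => ae_of_all _ fun x => ?_) (ae_of_all _ hpt)
    rw [Real.norm_eq_abs, abs_of_nonneg (hI k x).1]
    exact (hI k x).2
  exact le_of_tendsto' (t1.sub ((continuous_mul_log.tendsto _).comp t2))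
    fun k => entropy_pi_gaussianReal_sq_add_le hφ hsupp (he0 k)

lemma IsGaussianMeasure.map_pi_eq {W : Type*} [NormedAddCommGroup W] [NormedSpace ℝ W]
    [CompleteSpace W] [SecondCountableTopology W] [MeasurableSpace W] [BorelSpace W]
    {μ : Measure W} (hμ : IsGaussianMeasure μ) {n : ℕ} {f : Fin n → W →L[ℝ] ℝ}
    (horth : ∀ i j, ∫ x, f i x * f j x ∂μ = if i = j then 1 else 0) :
    μ.map (fun x i => f i x) = Measure.pi fun _ => gaussianReal 0 1 := by
  have : IsProbabilityMeasure μ := hμ.1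
  have : IsGaussian μ := isGaussian_of_map_eq_gaussianReal fun L => ⟨0, hμ.2 L⟩
  have hm : ∀ i, AEMeasurable (f i) μ := fun i => (f i).continuous.aemeasurable
  have hmap : ∀ i, μ.map (f i) = gaussianReal 0 1 := fun i => by
    obtain ⟨v, hv⟩ := hμ.2 (f i)
    have h1 : ∫ y, y ^ 2 ∂μ.map (f i) = 1 := by
      rw [integral_map (hm i) (by fun_prop)]
      simpa [sq] using horth i i
    rw [hv, integral_sq_gaussianReal] at h1
    rw [hv, show v = 1 from NNReal.coe_injective h1]
  have hmean : ∀ i, ∫ x, f i x ∂μ = 0 := fun i => by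
    have : ∫ y, y ∂μ.map (f i) = 0 := by rw [hmap i, integral_id_gaussianReal]
    rwa [integral_map (hm i) (by fun_prop)] at this
  have hlaw : HasGaussianLaw (fun x i => f i x) μ :=
    IsGaussian.hasGaussianLaw_id.map_fun (ContinuousLinearMap.pi f)
  have hind : iIndepFun (fun i => (f i : W → ℝ)) μ :=
    hlaw.iIndepFun_of_covariance_eq_zero fun i j hij => by
      rw [covariance_eq_sub (hlaw.eval i).memLp_two (hlaw.eval j).memLp_two]
      simp [hmean, horth, hij]
  rw [(iIndepFun_iff_map_fun_eq_pi_map hm).1 hind]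
  simp only [hmap]

end Entropy

/-- **Logarithmic Sobolev inequality for cylinder functions.** Let `μ` be a Gaussian
measure on a separable Banach space `W` and let `f₁, …, fₙ ∈ W*` be orthonormal for the
covariance form `q(f,g) = ∫ f(x) g(x) dμ`. For a smooth compactly supported
`φ : ℝⁿ → ℝ` and the cylinder function `F(x) = φ(f₁(x), …, fₙ(x))`,
`∫ F² ln |F| dμ ≤ ‖F‖²_{L²(μ)} ln ‖F‖_{L²(μ)} + ∫ ∑ᵢ |∂ᵢφ(f₁(x), …, fₙ(x))|² dμ`
(the convention `0² ln 0 = 0` holds automatically since `Real.log 0 = 0`;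
here `‖F‖_{L²(μ)} = √(∫ F² dμ)`). -/
theorem gaussian_log_sobolev_inequality_cylinder
    {W : Type*} [NormedAddCommGroup W] [NormedSpace ℝ W] [CompleteSpace W]
    [SecondCountableTopology W] [MeasurableSpace W] [BorelSpace W]
    (μ : Measure W) (hμ : IsGaussianMeasure μ)
    (n : ℕ) (f : Fin n → W →L[ℝ] ℝ)
    (horth : ∀ i j, ∫ x, f i x * f j x ∂μ = if i = j then 1 else 0)
    (φ : (Fin n → ℝ) → ℝ) (hφ : ContDiff ℝ (⊤ : ℕ∞) φ) (hsupp : HasCompactSupport φ) :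
    ∫ x, (φ (fun i => f i x)) ^ 2 * Real.log |φ (fun i => f i x)| ∂μ ≤
      (∫ x, (φ (fun i => f i x)) ^ 2 ∂μ) *
          Real.log (Real.sqrt (∫ x, (φ (fun i => f i x)) ^ 2 ∂μ)) +
        ∫ x, ∑ i, (fderiv ℝ φ (fun j => f j x) (Pi.single i 1)) ^ 2 ∂μ := by
  have hTm : AEMeasurable (fun x i => f i x) μ := by fun_prop
  have hlsi := entropy_pi_gaussianReal_sq_le hφ hsupp
  have hφc : Continuous φ := hφ.continuous
  have hdc : ∀ v, Continuous fun x => fderiv ℝ φ x v := fun v =>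
    (hφ.continuous_fderiv (by simp)).clm_apply continuous_const
  rw [← hμ.map_pi_eq horth, entropy_map (g := fun x => φ x ^ 2) hTm (by fun_prop),
    integral_map hTm (by fun_prop), entropy] at hlsi
  have e1 : ∫ x, φ (fun i => f i x) ^ 2 * Real.log (φ (fun i => f i x) ^ 2) ∂μ =
      2 * ∫ x, φ (fun i => f i x) ^ 2 * Real.log |φ (fun i => f i x)| ∂μ := by
    rw [← integral_const_mul]
    congr with x
    rw [← sq_abs (φ fun i => f i x), Real.log_pow]
    push_cast
    ring
  simp only [e1, ← Finset.mul_sum, integral_const_mul] at hlsi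
  rw [Real.log_sqrt (integral_nonneg fun x => sq_nonneg _)]
  linarith
end
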